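/- arXiv:2510.07523 — 3 statements merged into one kernel-verified Lean document; each statement's English description precedes it below -/
import Mathlib

section
/- Let (X,d) be a complete separable metric space, p > 1, and let λ ∈ P(C([0,T],X)) be concentrated on absolutely continuous curves with ∫∫₀ᵀ |γ̇|ᵖ(t) dt dλ(γ) < ∞ and with initial marginal (e₀)_♯λ ∈ P_p(X). Then the curve of measures μ_t := (e_t)_♯λ belongs to AC^p([0,T], P_p(X)) and its metric derivative with respect to the p-Wasserstein distance satisfies |μ̇|_{W_p}^p(t) ≤ ∫ |γ̇|ᵖ(t) dλ(γ) for a.e. t ∈ [0,T]. -/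
open MeasureTheory Set ENNReal Filter

noncomputable section

/-- The set of couplings between two measures. -/
def couplings {α : Type*} [MeasurableSpace α] (μ ν : Measure α) : Set (Measure (α × α)) :=
  {π | π.map Prod.fst = μ ∧ π.map Prod.snd = ν}

/-- The `p`-th power of the `p`-Wasserstein distance. -/
def Wpp {α : Type*} [MeasurableSpace α] [PseudoEMetricSpace α] (p : ℝ)
    (μ ν : Measure α) : ℝ≥0∞ :=
  ⨅ π ∈ couplings μ ν, ∫⁻ z : α × α, edist z.1 z.2 ^ p ∂π

/-- Extension of a curve `γ : [0,T] → X` to `ℝ` by clamping. -/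
def extendIcc {X : Type*} [TopologicalSpace X] {T : ℝ} (hT : 0 ≤ T)
    (γ : C(Icc (0:ℝ) T, X)) : ℝ → X := fun r => γ (projIcc 0 T hT r)

/-- The metric derivative `|γ̇|(t)` of a curve. -/
def mSpeed {X : Type*} [PseudoMetricSpace X] (γ : ℝ → X) (t : ℝ) : ℝ :=
  limUnder (nhdsWithin t {t}ᶜ) (fun s => dist (γ s) (γ t) / |s - t|)

/-- The `p`-th power `|μ̇|^p(t)` of the metric derivative of a curve of measures with
respect to the `W_p` distance, in `p`-power form. -/
def pSpeedW {X : Type*} [MeasurableSpace X] [PseudoEMetricSpace X] (p : ℝ)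
    (μ : ℝ → Measure X) (t : ℝ) : ℝ≥0∞ :=
  limUnder (nhdsWithin t {t}ᶜ) (fun s => Wpp p (μ s) (μ t) / ENNReal.ofReal (|s - t| ^ p))

/-- `γ` is an absolutely continuous curve on `[0,T]` with an `L^p` speed density. -/
def IsACpOn {X : Type*} [PseudoMetricSpace X] (p T : ℝ) (γ : ℝ → X) : Prop :=
  ∃ g : ℝ → ℝ, (∀ r, 0 ≤ g r) ∧
    (∫⁻ r in Icc 0 T, ENNReal.ofReal (g r ^ p)) < ⊤ ∧
    ∀ ⦃s t : ℝ⦄, s ∈ Icc 0 T → t ∈ Icc 0 T → s ≤ t →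
      dist (γ s) (γ t) ≤ ∫ r in Icc s t, g r

open scoped Topology

/-- **Metric derivative.** A nonnegative, symmetric `D : ℝ → ℝ → ℝ` satisfying the triangle
inequality and dominated by the integral of an integrable function has a metric derivative
almost everywhere, and is dominated by the integral of that derivative. -/
theorem exists_metric_deriv_of_integrable {D : ℝ → ℝ → ℝ} (hnn : ∀ s t, 0 ≤ D s t)
    (hsymm : ∀ s t, D s t = D t s) (htri : ∀ r s t, D r t ≤ D r s + D s t)
    {g : ℝ → ℝ} (hg : Integrable g) (hg0 : ∀ r, 0 ≤ g r)
    (hD : ∀ s t, s ≤ t → D s t ≤ ∫ r in s..t, g r) :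
    ∃ m : ℝ → ℝ, Measurable m ∧ (∀ r, 0 ≤ m r) ∧ Integrable m ∧
      (∀ᵐ t, Tendsto (fun s => D s t / |s - t|) (𝓝[≠] t) (𝓝 (m t))) ∧
      ∀ s t, s ≤ t → D s t ≤ ∫ r in s..t, m r := by
  have hgi : ∀ a b, IntervalIntegrable g volume a b := fun a b => hg.intervalIntegrable
  let G : ℝ → ℝ := fun x => ∫ r in (0 : ℝ)..x, g r
  have hDG : ∀ s t, D s t ≤ |G s - G t| := by
    intro s t
    wlog hst : s ≤ t generalizing s t
    · rw [hsymm, abs_sub_comm]; exact this t s (le_of_not_ge hst)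
    rw [abs_sub_comm]
    refine (hD s t hst).trans (le_trans (le_of_eq ?_) (le_abs_self _))
    exact (intervalIntegral.integral_interval_sub_left (hgi _ _) (hgi _ _)).symm
  have hFD : ∀ q s t, |D s q - D t q| ≤ D s t := by
    intro q s t
    rw [abs_le]
    constructor
    · linarith [htri t s q, hsymm s t]
    · linarith [htri s t q]
  have hF_ac : ∀ q a b, AbsolutelyContinuousOnInterval (fun t => D t q) a b := by
    intro q a b
    have h1 : AbsolutelyContinuousOnInterval G (min a (min b 0)) (max a (max b 0)) := by
      apply IntervalIntegrable.absolutelyContinuousOnInterval_intervalIntegral (hgi _ _)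
      rw [uIcc_of_le (by grind)]
      constructor <;> grind
    have h2 : AbsolutelyContinuousOnInterval G a b := by
      apply h1.mono
      rw [uIcc_of_le (a := min a (min b 0)) (by grind)]
      intro x hx
      rw [mem_uIcc] at hx
      constructor <;> grind
    rw [absolutelyContinuousOnInterval_iff] at h2 ⊢
    intro ε hε
    obtain ⟨δ, hδ, h⟩ := h2 ε hε
    refine ⟨δ, hδ, fun E hE hlt => lt_of_le_of_lt (Finset.sum_le_sum fun i _ => ?_) (h E hE hlt)⟩
    rw [Real.dist_eq, Real.dist_eq]
    exact (hFD _ _ _).trans (hDG _ _)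
  have hF_diff : ∀ᵐ t, ∀ q : ℚ, DifferentiableAt ℝ (fun t => D t q) t := by
    rw [ae_all_iff]
    intro q
    have : ∀ᵐ t, ∀ n : ℕ, t ∈ uIcc (-(n:ℝ)) n → DifferentiableAt ℝ (fun t => D t q) t := by
      rw [ae_all_iff]
      exact fun n => (hF_ac q _ _).ae_differentiableAt
    filter_upwards [this] with t ht
    obtain ⟨n, hn⟩ := exists_nat_ge |t|
    refine ht n ?_
    rw [uIcc_of_le (by linarith [abs_nonneg t])]
    exact abs_le.1 hn
  have habs : ∀ {f : ℝ → ℝ} {f' t : ℝ}, HasDerivAt f f' t →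
      Tendsto (fun s => |f s - f t| / |s - t|) (𝓝[≠] t) (𝓝 |f'|) := by
    intro f f' t h
    refine (hasDerivAt_iff_tendsto_slope.1 h).abs.congr fun s => ?_
    rw [slope_def_field, abs_div]
  have hle_g : ∀ᵐ t, ∀ q : ℚ, |deriv (fun t => D t q) t| ≤ g t := by
    filter_upwards [hF_diff,
      _root_.LocallyIntegrable.ae_hasDerivAt_integral hg.locallyIntegrable] with t h1 h2 q
    have := le_of_tendsto_of_tendsto' (habs (h1 q).hasDerivAt) (habs (h2 0)) fun s =>
      div_le_div_of_nonneg_right ((hFD q s t).trans (hDG s t)) (abs_nonneg (s - t))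
    rwa [abs_of_nonneg (hg0 t)] at this
  let m : ℝ → ℝ := fun t => ⨆ q : ℚ, |deriv (fun t => D t q) t|
  have hm_meas : Measurable m := by
    refine Measurable.iSup fun q => ?_
    exact (measurable_deriv fun t => D t q).norm
  have hm0 : ∀ r, 0 ≤ m r := fun r => Real.iSup_nonneg fun q => abs_nonneg _
  have hmg : ∀ᵐ t, m t ≤ g t := by
    filter_upwards [hle_g] with t ht using ciSup_le ht
  have hm_int : Integrable m := by
    refine hg.mono' hm_meas.aestronglyMeasurable ?_
    filter_upwards [hmg] with t ht
    rwa [Real.norm_of_nonneg (hm0 t)]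
  have hmi : ∀ a b, IntervalIntegrable m volume a b := fun a b => hm_int.intervalIntegrable
  have hle_m : ∀ᵐ t, ∀ q : ℚ, |deriv (fun t => D t q) t| ≤ m t := by
    filter_upwards [hle_g] with t ht q
    exact le_ciSup (f := fun q : ℚ => |deriv (fun t => D t q) t|)
      ⟨g t, by rintro _ ⟨q, rfl⟩; exact ht q⟩ q
  have hGc : Continuous G := intervalIntegral.continuous_primitive hgi 0
  have hDm : ∀ s t, s ≤ t → D s t ≤ ∫ r in s..t, m r := by
    intro s t hst
    refine le_of_forall_pos_le_add fun ε hε => ?_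
    obtain ⟨q, hq⟩ : ∃ q : ℚ, |G s - G q| < ε / 2 := by
      have ho : IsOpen {x : ℝ | |G s - G x| < ε / 2} :=
        isOpen_lt (by fun_prop) continuous_const
      obtain ⟨q, hq⟩ := Rat.denseRange_cast (𝕜 := ℝ) |>.exists_mem_open ho ⟨s, by simpa using hε⟩
      exact ⟨q, hq⟩
    have h1 : D t q - D s q ≤ ∫ r in s..t, m r := by
      rw [← (hF_ac q s t).integral_deriv_eq_sub]
      refine intervalIntegral.integral_mono_ae hst (hF_ac q s t).intervalIntegrable_deriv
        (hmi _ _) ?_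
      filter_upwards [hle_m] with r hr using (le_abs_self _).trans (hr q)
    have h2 := hDG s q
    linarith [htri s q t, hsymm q t]
  refine ⟨m, hm_meas, hm0, hm_int, ?_, hDm⟩
  filter_upwards [hF_diff,
    _root_.LocallyIntegrable.ae_hasDerivAt_integral hm_int.locallyIntegrable] with t h1 h2
  rw [tendsto_order]
  constructor
  · intro c hc
    obtain ⟨q, hq⟩ := exists_lt_of_lt_ciSup hc
    filter_upwards [(habs (h1 q).hasDerivAt).eventually_const_lt hq] with s hs
    refine hs.trans_le ?_
    gcongr
    exact hFD _ _ _
  · intro c hc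
    have h3 := habs (h2 0)
    rw [abs_of_nonneg (hm0 t)] at h3
    filter_upwards [h3.eventually_lt_const hc] with s hs
    refine lt_of_le_of_lt ?_ hs
    gcongr
    rcases le_total s t with hst | hst
    · rw [abs_sub_comm]
      refine (hDm s t hst).trans (le_trans (le_of_eq ?_) (le_abs_self _))
      exact (intervalIntegral.integral_interval_sub_left (hmi _ _) (hmi _ _)).symm
    · rw [hsymm]
      refine (hDm t s hst).trans (le_trans (le_of_eq ?_) (le_abs_self _))
      exact (intervalIntegral.integral_interval_sub_left (hmi _ _) (hmi _ _)).symm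

/-- A possibly non-measurable function with finite integral over `I` dominates a measurable
function with the same integral over every measurable subset of `I`. -/
theorem exists_measurable_le_setLIntegral_eq {α : Type*} [MeasurableSpace α] {ν : Measure α}
    {I : Set α} (g : α → ℝ≥0∞) (hg : ∫⁻ r in I, g r ∂ν ≠ ⊤) :
    ∃ h : α → ℝ≥0∞, Measurable h ∧ ∫⁻ r in I, h r ∂ν ≠ ⊤ ∧
      ∀ A ⊆ I, MeasurableSet A → ∫⁻ r in A, g r ∂ν = ∫⁻ r in A, h r ∂ν := by
  obtain ⟨h, hm, hle, heq⟩ := MeasureTheory.exists_measurable_le_lintegral_eq (ν.restrict I) g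
  refine ⟨h, hm, heq ▸ hg, fun A hAI hA => ?_⟩
  have e1 := lintegral_add_compl (μ := ν.restrict I) g hA
  have e2 := lintegral_add_compl (μ := ν.restrict I) h hA
  rw [Measure.restrict_restrict hA, inter_eq_left.2 hAI] at e1 e2
  have l1 : ∫⁻ r in A, h r ∂ν ≤ ∫⁻ r in A, g r ∂ν := lintegral_mono hle
  have l2 : ∫⁻ r in Aᶜ, h r ∂(ν.restrict I) ≤ ∫⁻ r in Aᶜ, g r ∂(ν.restrict I) :=
    lintegral_mono hle
  refine le_antisymm ?_ l1
  by_contra! hlt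
  have hfin : ∫⁻ r in Aᶜ, h r ∂(ν.restrict I) ≠ ⊤ := by
    refine ne_top_of_le_ne_top (heq ▸ hg) ?_
    rw [← e2]; exact le_add_self
  exact (ENNReal.add_lt_add_of_lt_of_le hfin hlt l2).ne (by rw [e1, e2, heq])

/-- Metric derivative of a pseudo-distance on `[0,T]`, extended to `ℝ` by clamping. -/
theorem exists_metric_deriv {T : ℝ} (hT : 0 ≤ T) {D : ℝ → ℝ → ℝ} (hnn : ∀ s t, 0 ≤ D s t)
    (hsymm : ∀ s t, D s t = D t s) (htri : ∀ r s t, D r t ≤ D r s + D s t)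
    (hclamp : ∀ s t, D (projIcc 0 T hT s) (projIcc 0 T hT t) = D s t)
    {g : ℝ → ℝ≥0∞} (hg : ∫⁻ r in Icc 0 T, g r ≠ ⊤)
    (hD : ∀ s ∈ Icc 0 T, ∀ t ∈ Icc 0 T, s ≤ t → ENNReal.ofReal (D s t) ≤ ∫⁻ r in Icc s t, g r) :
    ∃ m : ℝ → ℝ, Measurable m ∧ (∀ r, 0 ≤ m r) ∧
      (∀ᵐ t, Tendsto (fun s => D s t / |s - t|) (𝓝[≠] t) (𝓝 (m t))) ∧
      ∀ s t, s ≤ t → ENNReal.ofReal (D s t) ≤ ∫⁻ r in Icc s t, ENNReal.ofReal (m r) := by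
  obtain ⟨h, hm, hfin, heq⟩ := exists_measurable_le_setLIntegral_eq g hg
  let k : ℝ → ℝ≥0∞ := (Icc 0 T).indicator h
  have hk : Measurable k := hm.indicator measurableSet_Icc
  have hk_fin : ∫⁻ r, k r ≠ ⊤ := by rwa [lintegral_indicator measurableSet_Icc]
  have hDk : ∀ s t, s ≤ t → D s t ≤ ∫ r in s..t, (k r).toReal := by
    intro s t hst
    have hle : (projIcc 0 T hT s : ℝ) ≤ projIcc 0 T hT t := monotone_projIcc hT hst
    have hsub : Icc (projIcc 0 T hT s : ℝ) (projIcc 0 T hT t) ⊆ Icc 0 T :=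
      Icc_subset_Icc (projIcc 0 T hT s).2.1 (projIcc 0 T hT t).2.2
    have h1 := hD _ (projIcc 0 T hT s).2 _ (projIcc 0 T hT t).2 hle
    rw [hclamp, heq _ hsub measurableSet_Icc, setLIntegral_congr_fun measurableSet_Icc
      (g := k) (fun r hr => (indicator_of_mem (hsub hr) h).symm)] at h1
    have hsub2 : Ioc (projIcc 0 T hT s : ℝ) (projIcc 0 T hT t) ⊆ Ioc s t := by
      intro r hr
      simp only [projIcc, mem_Ioc] at hr ⊢
      constructor <;> grind
    rw [← Measure.restrict_congr_set Ioc_ae_eq_Icc] at h1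
    have h2 := h1.trans (lintegral_mono_set hsub2)
    have hne : ∫⁻ r in Ioc s t, k r ≠ ⊤ :=
      ne_top_of_le_ne_top hk_fin (setLIntegral_le_lintegral _ _)
    rw [intervalIntegral.integral_of_le hst, integral_toReal hk.aemeasurable
      (ae_lt_top hk hne)]
    exact (ENNReal.ofReal_le_iff_le_toReal hne).1 h2
  obtain ⟨m, h1, h2, h3, h4, h5⟩ := exists_metric_deriv_of_integrable hnn hsymm htri
    (integrable_toReal_of_lintegral_ne_top hk.aemeasurable hk_fin)
    (fun r => ENNReal.toReal_nonneg) hDk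
  refine ⟨m, h1, h2, h4, fun s t hst => ?_⟩
  rw [← Measure.restrict_congr_set Ioc_ae_eq_Icc, ← ofReal_integral_eq_lintegral_ofReal h3.restrict
    (ae_of_all _ h2), ← intervalIntegral.integral_of_le hst]
  exact ENNReal.ofReal_le_ofReal (h5 s t hst)

open ProbabilityTheory in
/-- **Gluing.** Two couplings with a common marginal come from a single measure on the product
of the three spaces. -/
theorem exists_gluing {α : Type*} [MeasurableSpace α] [StandardBorelSpace α] [Nonempty α]
    {μ ν ρ : Measure α} [IsProbabilityMeasure ν]
    {π₁ π₂ : Measure (α × α)} (h₁ : π₁ ∈ couplings μ ν) (h₂ : π₂ ∈ couplings ν ρ) :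
    ∃ σ : Measure (α × α × α), σ.map (fun z => (z.1, z.2.1)) = π₁ ∧ σ.map Prod.snd = π₂ := by
  have hfin₂ : IsFiniteMeasure π₂ := by
    have : IsFiniteMeasure (π₂.map Prod.fst) := by rw [h₂.1]; infer_instance
    exact Measure.isFiniteMeasure_of_map measurable_fst.aemeasurable
  have hfin₁ : IsFiniteMeasure π₁ := by
    have : IsFiniteMeasure (π₁.map Prod.snd) := by rw [h₁.2]; infer_instance
    exact Measure.isFiniteMeasure_of_map measurable_snd.aemeasurable
  have hfst₁ : (π₁.map Prod.swap).fst = ν := by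
    rw [Measure.fst, Measure.map_map measurable_fst measurable_swap]
    exact h₁.2
  have hfst₂ : π₂.fst = ν := h₂.1
  have e₁ : ν ⊗ₘ (π₁.map Prod.swap).condKernel = π₁.map Prod.swap := by
    rw [← hfst₁]; exact (π₁.map Prod.swap).disintegrate _
  have e₂ : ν ⊗ₘ π₂.condKernel = π₂ := by
    rw [← hfst₂]; exact π₂.disintegrate _
  let κ : Kernel α (α × α) := (π₁.map Prod.swap).condKernel ×ₖ π₂.condKernel
  refine ⟨(ν ⊗ₘ κ).map (fun z => (z.2.1, z.1, z.2.2)), ?_, ?_⟩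
  · have : (ν ⊗ₘ κ).map (Prod.map id Prod.fst) = π₁.map Prod.swap := by
      rw [← Measure.compProd_map measurable_fst, ← Kernel.fst_eq, Kernel.fst_prod, e₁]
    rw [Measure.map_map (by fun_prop) (by fun_prop)]
    calc _ = ((ν ⊗ₘ κ).map (Prod.map id Prod.fst)).map Prod.swap := by
            rw [Measure.map_map (by fun_prop) (by fun_prop)]; rfl
      _ = π₁ := by
            rw [this, Measure.map_map (by fun_prop) (by fun_prop), Prod.swap_swap_eq,
              Measure.map_id]
  · have : (ν ⊗ₘ κ).map (Prod.map id Prod.snd) = π₂ := by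
      rw [← Measure.compProd_map measurable_snd, ← Kernel.snd_eq, Kernel.snd_prod, e₂]
    rw [Measure.map_map (by fun_prop) (by fun_prop)]
    exact this

section Wasserstein

variable {X : Type*} [MeasurableSpace X] [PseudoEMetricSpace X]

theorem Wpp_comm [OpensMeasurableSpace X] [SecondCountableTopology X] (p : ℝ) (μ ν : Measure X) :
    Wpp p μ ν = Wpp p ν μ := by
  have key : ∀ μ ν : Measure X, Wpp p μ ν ≤ Wpp p ν μ := by
    intro μ ν
    refine le_iInf₂ fun π hπ => ?_
    refine (iInf₂_le (π.map Prod.swap) ?_).trans (le_of_eq ?_)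
    · constructor
      · rw [Measure.map_map measurable_fst measurable_swap]; exact hπ.2
      · rw [Measure.map_map measurable_snd measurable_swap]; exact hπ.1
    · rw [lintegral_map (by fun_prop) measurable_swap]
      simp [edist_comm]
  exact le_antisymm (key μ ν) (key ν μ)

theorem Wpp_rpow_inv {p : ℝ} (hp : 0 < p) (μ ν : Measure X) :
    Wpp p μ ν ^ (1 / p) = ⨅ π : couplings μ ν, (∫⁻ z, edist z.1 z.2 ^ p ∂π.1) ^ (1 / p) := by
  rw [Wpp, iInf_subtype']
  exact (ENNReal.orderIsoRpow (1 / p) (by positivity)).map_iInf _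

theorem Wpp_triangle [OpensMeasurableSpace X] [SecondCountableTopology X]
    [StandardBorelSpace X] [Nonempty X] {p : ℝ} (hp : 1 ≤ p) (μ ν ρ : Measure X)
    [IsProbabilityMeasure ν] :
    Wpp p μ ρ ^ (1 / p) ≤ Wpp p μ ν ^ (1 / p) + Wpp p ν ρ ^ (1 / p) := by
  have hp0 : 0 < p := by linarith
  rw [Wpp_rpow_inv hp0 μ ν, Wpp_rpow_inv hp0 ν ρ, ENNReal.iInf_add]
  refine le_iInf fun π₁ => ?_
  rw [ENNReal.add_iInf]
  refine le_iInf fun π₂ => ?_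
  obtain ⟨σ, h₁, h₂⟩ := exists_gluing π₁.2 π₂.2
  have hc : σ.map (fun z => (z.1, z.2.2)) ∈ couplings μ ρ := by
    constructor
    · rw [Measure.map_map (by fun_prop) (by fun_prop), ← π₁.2.1, ← h₁,
        Measure.map_map (by fun_prop) (by fun_prop)]
      rfl
    · rw [Measure.map_map (by fun_prop) (by fun_prop), ← π₂.2.2, ← h₂,
        Measure.map_map (by fun_prop) (by fun_prop)]
      rfl
  have hd : Measurable fun z : X × X => edist z.1 z.2 ^ p := by fun_prop
  rw [← h₁, ← h₂, lintegral_map hd (by fun_prop), lintegral_map hd (by fun_prop)]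
  calc Wpp p μ ρ ^ (1 / p)
      ≤ (∫⁻ z, edist z.1 z.2.2 ^ p ∂σ) ^ (1 / p) := by
        refine ENNReal.rpow_le_rpow ?_ (by positivity)
        refine (iInf₂_le _ hc).trans (le_of_eq ?_)
        rw [lintegral_map hd (by fun_prop)]
    _ ≤ (∫⁻ z, ((fun z : X × X × X => edist z.1 z.2.1) +
          fun z : X × X × X => edist z.2.1 z.2.2) z ^ p ∂σ)
          ^ (1 / p) := by
        gcongr
        exact edist_triangle _ _ _
    _ ≤ _ := ENNReal.lintegral_Lp_add_le (by fun_prop) (by fun_prop) hp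

end Wasserstein

/-- Jensen's inequality for the power `p` on an interval. -/
theorem rpow_setLIntegral_Icc_le {p : ℝ} (hp : 1 < p) {f : ℝ → ℝ≥0∞} (hf : Measurable f)
    (s t : ℝ) :
    (∫⁻ r in Icc s t, f r) ^ p ≤
      ENNReal.ofReal (t - s) ^ (p - 1) * ∫⁻ r in Icc s t, f r ^ p := by
  have hpq := Real.HolderConjugate.conjExponent hp
  have h := ENNReal.lintegral_mul_le_Lp_mul_Lq (volume.restrict (Icc s t)) hpq
    hf.aemeasurable (aemeasurable_const (b := (1 : ℝ≥0∞)))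
  simp only [Pi.mul_apply, mul_one, ENNReal.one_rpow, lintegral_const, one_mul,
    Measure.restrict_apply_univ, Real.volume_Icc] at h
  have hp0 : 0 < p := by linarith
  calc _ ≤ _ := ENNReal.rpow_le_rpow h hp0.le
    _ = _ := by
      rw [ENNReal.mul_rpow_of_nonneg _ _ hp0.le, ← ENNReal.rpow_mul, ← ENNReal.rpow_mul,
        one_div_mul_cancel hp0.ne', ENNReal.rpow_one, mul_comm]
      congr 2
      rw [Real.conjExponent]
      field_simp

/-- A limit at a punctured point, along rationals, of a function continuous off that point is a
full limit. -/
theorem tendsto_punctured_of_tendsto_rat {f : ℝ → ℝ} (hf : ContinuousOn f {0}ᶜ) {L : ℝ}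
    (h : Tendsto (fun q : ℚ => f q) (comap ((↑) : ℚ → ℝ) (𝓝[≠] 0)) (𝓝 L)) :
    Tendsto f (𝓝[≠] 0) (𝓝 L) := by
  rw [Metric.tendsto_nhds]
  intro ε hε
  have h1 := (Metric.tendsto_nhds.1 h) (ε / 2) (by positivity)
  rw [eventually_comap, eventually_nhdsWithin_iff, Metric.eventually_nhds_iff] at h1
  obtain ⟨δ, hδ, h1⟩ := h1
  rw [eventually_nhdsWithin_iff, Metric.eventually_nhds_iff]
  refine ⟨δ, hδ, fun {y} hy hy0 => ?_⟩
  by_contra! hlt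
  have ho : IsOpen ({0}ᶜ ∩ f ⁻¹' {z | ε / 2 < dist z L}) :=
    hf.isOpen_inter_preimage isOpen_compl_singleton (isOpen_lt (by fun_prop) (by fun_prop))
  obtain ⟨q, hq⟩ := (Rat.denseRange_cast (𝕜 := ℝ)).exists_mem_open
    (ho.inter (Metric.isOpen_ball (x := (0 : ℝ)) (ε := δ)))
    ⟨y, ⟨hy0, by simp only [mem_preimage, mem_ofPred_eq]; linarith⟩, hy⟩
  exact lt_asymm hq.1.2 (h1 hq.2 hq.1.1 q rfl)

section Speed

variable {X : Type*} [MetricSpace X] {T : ℝ} (hT : 0 ≤ T)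

theorem continuous_extendIcc :
    Continuous fun z : C(Icc (0:ℝ) T, X) × ℝ => extendIcc hT z.1 z.2 := by
  unfold extendIcc
  fun_prop

/-- A jointly measurable version of the metric speed of a curve. -/
theorem exists_measurable_mSpeed [MeasurableSpace C(Icc (0:ℝ) T, X)]
    [OpensMeasurableSpace C(Icc (0:ℝ) T, X)] :
    ∃ (S : C(Icc (0:ℝ) T, X) × ℝ → ℝ) (B : Set (C(Icc (0:ℝ) T, X) × ℝ)),
      Measurable S ∧ MeasurableSet B ∧ (∀ z ∈ B, mSpeed (extendIcc hT z.1) z.2 = S z) ∧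
      ∀ γ t l, Tendsto (fun s => dist (extendIcc hT γ s) (extendIcc hT γ t) / |s - t|)
        (𝓝[≠] t) (𝓝 l) → (γ, t) ∈ B := by
  let Q : ℝ → C(Icc (0:ℝ) T, X) × ℝ → ℝ := fun h z =>
    dist (extendIcc hT z.1 (z.2 + h)) (extendIcc hT z.1 z.2) / |h|
  have hE := continuous_extendIcc (X := X) hT
  have hQd : Continuous fun w : ℝ × (C(Icc (0:ℝ) T, X) × ℝ) =>
      dist (extendIcc hT w.2.1 (w.2.2 + w.1)) (extendIcc hT w.2.1 w.2.2) :=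
    (hE.comp (f := fun w : ℝ × (C(Icc (0:ℝ) T, X) × ℝ) => (w.2.1, w.2.2 + w.1))
      (by fun_prop)).dist
      (hE.comp (f := fun w : ℝ × (C(Icc (0:ℝ) T, X) × ℝ) => w.2) (by fun_prop))
  have hQm : ∀ h, Measurable (Q h) := fun h =>
    ((hQd.comp (f := fun z => (h, z)) (by fun_prop)).measurable).div_const _
  let u : ℕ → ℝ := fun n => 1 / ((n : ℝ) + 1)
  let S : C(Icc (0:ℝ) T, X) × ℝ → ℝ := fun z => liminf (fun n => Q (u n) z) atTop
  have hS : Measurable S := Measurable.liminf fun n => hQm _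
  have hshift : ∀ γ t l, Tendsto (fun s => dist (extendIcc hT γ s) (extendIcc hT γ t) / |s - t|)
        (𝓝[≠] t) (𝓝 l) ↔ Tendsto (fun h => Q h (γ, t)) (𝓝[≠] 0) (𝓝 l) := by
    intro γ t l
    have : map (fun h => t + h) (𝓝[≠] (0:ℝ)) = 𝓝[≠] t := by
      simp
    rw [← this, tendsto_map'_iff]
    refine tendsto_congr fun h => ?_
    simp [Q]
  refine ⟨S, {z | Tendsto (fun q : ℚ => Q q z) (comap ((↑) : ℚ → ℝ) (𝓝[≠] 0)) (𝓝 (S z))}, hS,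
    measurableSet_tendsto_fun (f := fun (q : ℚ) z => Q q z) (fun q => hQm q) hS,
    fun z hz => ?_, fun γ t l hl => ?_⟩
  · refine Tendsto.limUnder_eq ((hshift _ _ _).2 (tendsto_punctured_of_tendsto_rat ?_ hz))
    intro h hh
    refine ContinuousAt.continuousWithinAt (ContinuousAt.div ?_ continuous_abs.continuousAt ?_)
    · exact (hQd.comp (f := fun h => (h, z)) (by fun_prop)).continuousAt
    · simpa using hh
  · rw [hshift] at hl
    have hu : Tendsto u atTop (𝓝[≠] 0) :=
      tendsto_nhdsWithin_iff.2 ⟨tendsto_one_div_add_atTop_nhds_zero_nat,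
        Eventually.of_forall fun n => by
          simp only [u, mem_compl_iff, mem_singleton_iff]
          positivity⟩
    have : S (γ, t) = l := (hl.comp hu).liminf_eq
    rw [mem_ofPred_eq, this]
    exact hl.comp tendsto_comap

end Speed

/-- A curve of measures whose `W_p`-increments are controlled by `(t - s)^(p-1) ∫ₛᵗ H` is
`p`-absolutely continuous and its metric derivative satisfies `|μ̇|^p ≤ H` almost everywhere. -/
theorem exists_speed_of_Wpp_le {X : Type*} [MeasurableSpace X] [PseudoEMetricSpace X]
    [OpensMeasurableSpace X] [SecondCountableTopology X] [StandardBorelSpace X] [Nonempty X]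
    {T p : ℝ} (hT : 0 ≤ T) (hp : 1 < p) {μ : ℝ → Measure X} [∀ t, IsProbabilityMeasure (μ t)]
    (hclamp : ∀ t, μ (projIcc 0 T hT t) = μ t) {H : ℝ → ℝ≥0∞} (hH : Measurable H)
    (hfin : ∫⁻ r in Icc 0 T, H r ≠ ⊤)
    (hW : ∀ s ∈ Icc 0 T, ∀ t ∈ Icc 0 T, s ≤ t →
      Wpp p (μ s) (μ t) ≤ ENNReal.ofReal (t - s) ^ (p - 1) * ∫⁻ r in Icc s t, H r) :
    ∃ m : ℝ → ℝ≥0∞, (∀ᵐ t ∂(volume.restrict (Icc 0 T)), m t ^ p ≤ H t ∧ pSpeedW p μ t = m t ^ p) ∧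
      ∀ s ∈ Icc 0 T, ∀ t ∈ Icc 0 T, s ≤ t →
        Wpp p (μ s) (μ t) ≤ (∫⁻ r in Icc s t, m r) ^ p := by
  have hp0 : 0 < p := by linarith
  have hp1 : 0 ≤ p - 1 := by linarith
  have hip : 0 < 1 / p := by positivity
  have hcW : ∀ s t, Wpp p (μ (projIcc 0 T hT s)) (μ (projIcc 0 T hT t)) = Wpp p (μ s) (μ t) := by
    intro s t; rw [hclamp, hclamp]
  have hfin' : ∀ s ∈ Icc 0 T, ∀ t ∈ Icc 0 T, ∫⁻ r in Icc s t, H r ≠ ⊤ := fun s hs t ht =>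
    ne_top_of_le_ne_top hfin (lintegral_mono_set (Icc_subset_Icc hs.1 ht.2))
  have hWfin : ∀ s t, Wpp p (μ s) (μ t) ≠ ⊤ := by
    have h0 : ∀ s ∈ Icc 0 T, ∀ t ∈ Icc 0 T, s ≤ t → Wpp p (μ s) (μ t) ≠ ⊤ := fun s hs t ht hst =>
      ne_top_of_le_ne_top (ENNReal.mul_ne_top (ENNReal.rpow_ne_top_of_nonneg hp1
        ENNReal.ofReal_ne_top) (hfin' s hs t ht)) (hW s hs t ht hst)
    intro s t
    rw [← hcW]
    rcases le_total (projIcc 0 T hT s : ℝ) (projIcc 0 T hT t) with h | h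
    · exact h0 _ (Subtype.coe_prop _) _ (Subtype.coe_prop _) h
    · rw [Wpp_comm]
      exact h0 _ (Subtype.coe_prop _) _ (Subtype.coe_prop _) h
  have hWfin' : ∀ s t, Wpp p (μ s) (μ t) ^ (1 / p) ≠ ⊤ := fun s t =>
    ENNReal.rpow_ne_top_of_nonneg hip.le (hWfin s t)
  let D : ℝ → ℝ → ℝ := fun s t => (Wpp p (μ s) (μ t) ^ (1 / p)).toReal
  have hD0 : ∀ s t, 0 ≤ D s t := fun s t => ENNReal.toReal_nonneg
  have hDsymm : ∀ s t, D s t = D t s := fun s t => by simp only [D]; rw [Wpp_comm]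
  have hofD : ∀ s t, ENNReal.ofReal (D s t) = Wpp p (μ s) (μ t) ^ (1 / p) := fun s t =>
    ENNReal.ofReal_toReal (hWfin' s t)
  have hofDp : ∀ s t, ENNReal.ofReal (D s t) ^ p = Wpp p (μ s) (μ t) := fun s t => by
    rw [hofD, ← ENNReal.rpow_mul, one_div_mul_cancel hp0.ne', ENNReal.rpow_one]
  obtain ⟨m, -, hm0, hlim, hDm⟩ := exists_metric_deriv (D := D) (g := fun r => 1 + H r) hT hD0
    hDsymm
    (fun r s t => by
      simp only [D]
      rw [← ENNReal.toReal_add (hWfin' _ _) (hWfin' _ _)]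
      exact ENNReal.toReal_mono (ENNReal.add_ne_top.2 ⟨hWfin' _ _, hWfin' _ _⟩)
        (Wpp_triangle hp.le _ _ _))
    (fun s t => by simp only [D, hcW])
    (by
      rw [lintegral_add_left measurable_const]
      simp [hfin])
    (fun s hs t ht hst => by
      rw [hofD, lintegral_add_left measurable_const]
      simp only [lintegral_const, Measure.restrict_apply_univ, Real.volume_Icc, one_mul]
      rw [one_div, ENNReal.rpow_inv_le_iff hp0]
      refine (hW s hs t ht hst).trans ?_
      set a := ENNReal.ofReal (t - s)
      set b := ∫⁻ r in Icc s t, H r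
      calc a ^ (p - 1) * b ≤ (a + b) ^ (p - 1) * (a + b) ^ (1 : ℝ) := by
            rw [ENNReal.rpow_one]
            gcongr
            · exact le_self_add
            · exact le_add_self
        _ = (a + b) ^ p := by
            rw [← ENNReal.rpow_add_of_nonneg _ _ hp1 zero_le_one]; simp)
  refine ⟨fun r => ENNReal.ofReal (m r), ?_, fun s hs t ht hst => ?_⟩
  swap
  · rw [← hofDp]
    exact ENNReal.rpow_le_rpow (hDm s t hst) hp0.le
  let h : ℝ → ℝ := (Icc 0 T).indicator fun r => (H r).toReal
  have hh : Integrable h := by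
    rw [integrable_indicator_iff measurableSet_Icc]
    exact integrable_toReal_of_lintegral_ne_top hH.aemeasurable hfin
  have hhi : ∀ a b, IntervalIntegrable h volume a b := fun a b => hh.intervalIntegrable
  have hh0 : ∀ r, 0 ≤ h r := fun r => indicator_nonneg (fun _ _ => ENNReal.toReal_nonneg) _
  have hHt : ∀ᵐ t ∂(volume.restrict (Icc 0 T)), H t < ⊤ := ae_lt_top hH hfin
  have hint : ∀ s ∈ Icc 0 T, ∀ t ∈ Icc 0 T, s ≤ t →
      ∫ r in s..t, h r = (∫⁻ r in Icc s t, H r).toReal := by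
    intro s hs t ht hst
    have hsub : Icc s t ⊆ Icc 0 T := Icc_subset_Icc hs.1 ht.2
    rw [intervalIntegral.integral_of_le hst, ← integral_Icc_eq_integral_Ioc,
      setIntegral_congr_fun measurableSet_Icc (fun r hr => indicator_of_mem (hsub hr) _),
      integral_toReal hH.aemeasurable (ae_restrict_of_ae_restrict_of_subset hsub hHt)]
  let Φ : ℝ → ℝ := fun x => ∫ r in (0 : ℝ)..x, h r
  have hDΦ : ∀ s ∈ Icc 0 T, ∀ t ∈ Icc 0 T, D s t ^ p ≤ |s - t| ^ (p - 1) * |Φ s - Φ t| := by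
    intro s hs t ht
    wlog hst : s ≤ t generalizing s t
    · rw [hDsymm, abs_sub_comm s, abs_sub_comm (Φ s)]
      exact this t ht s hs (le_of_not_ge hst)
    have e : Φ t - Φ s = (∫⁻ r in Icc s t, H r).toReal := by
      rw [← hint s hs t ht hst]
      exact intervalIntegral.integral_interval_sub_left (hhi _ _) (hhi _ _)
    rw [abs_sub_comm s, abs_sub_comm (Φ s), e, abs_of_nonneg ENNReal.toReal_nonneg,
      abs_of_nonneg (sub_nonneg.2 hst)]
    have h1 := hW s hs t ht hst
    rw [← hofDp, ENNReal.ofReal_rpow_of_nonneg (hD0 _ _) hp0.le,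
      ENNReal.ofReal_rpow_of_nonneg (sub_nonneg.2 hst) hp1] at h1
    have h2 := (ENNReal.ofReal_le_iff_le_toReal (ENNReal.mul_ne_top ENNReal.ofReal_ne_top
      (hfin' s hs t ht))).1 h1
    rwa [ENNReal.toReal_mul, ENNReal.toReal_ofReal (by have := sub_nonneg.2 hst; positivity)] at h2
  have hIoo : ∀ᵐ t ∂(volume.restrict (Icc 0 T)), t ∈ Ioo 0 T := by
    rw [← Measure.restrict_congr_set Ioo_ae_eq_Icc]
    exact ae_restrict_mem measurableSet_Ioo
  filter_upwards [ae_restrict_of_ae hlim,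
    ae_restrict_of_ae (_root_.LocallyIntegrable.ae_hasDerivAt_integral hh.locallyIntegrable), hHt,
    hIoo] with t h1 h2 h3 ht
  have htI := Ioo_subset_Icc_self ht
  have hlimp := h1.rpow_const (p := p) (Or.inr hp0.le)
  constructor
  · have h4 : Tendsto (fun s => |Φ s - Φ t| / |s - t|) (𝓝[≠] t) (𝓝 |h t|) := by
      refine (hasDerivAt_iff_tendsto_slope.1 (h2 0)).abs.congr fun s => ?_
      rw [slope_def_field, abs_div]
    have h5 : m t ^ p ≤ |h t| := by
      refine le_of_tendsto_of_tendsto hlimp h4 ?_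
      filter_upwards [nhdsWithin_le_nhds (Icc_mem_nhds ht.1 ht.2),
        self_mem_nhdsWithin] with s hs hst
      have hpos : 0 < |s - t| := abs_pos.2 (sub_ne_zero.2 hst)
      rw [Real.div_rpow (hD0 _ _) hpos.le, div_le_div_iff₀ (by positivity) hpos]
      calc D s t ^ p * |s - t| ≤ (|s - t| ^ (p - 1) * |Φ s - Φ t|) * |s - t| := by
            gcongr; exact hDΦ s hs t htI
        _ = |Φ s - Φ t| * |s - t| ^ p := by
            rw [Real.rpow_sub_one hpos.ne']; field_simp
    rw [abs_of_nonneg (hh0 t)] at h5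
    simp only [h, indicator_of_mem htI] at h5
    rw [ENNReal.ofReal_rpow_of_nonneg (hm0 t) hp0.le]
    exact ENNReal.ofReal_le_of_le_toReal h5
  · rw [ENNReal.ofReal_rpow_of_nonneg (hm0 t) hp0.le]
    refine Tendsto.limUnder_eq ((ENNReal.tendsto_ofReal hlimp).congr' ?_)
    filter_upwards [self_mem_nhdsWithin] with s hst
    have hpos : 0 < |s - t| := abs_pos.2 (sub_ne_zero.2 hst)
    rw [Real.div_rpow (hD0 _ _) hpos.le, ENNReal.ofReal_div_of_pos (by positivity),
      ← ENNReal.ofReal_rpow_of_nonneg (hD0 _ _) hp0.le, hofDp]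

/-- Let `(X,d)` be complete separable, `p > 1`, and let
`λ ∈ P(C([0,T],X))` be concentrated on absolutely continuous curves with
`∫∫₀ᵀ |γ̇|^p dt dλ < ∞` and `(e₀)_♯λ ∈ P_p(X)`.  Then the curve `μ_t := (e_t)_♯λ` belongs
to `AC^p([0,T], P_p(X))` and `|μ̇|_{W_p}^p(t) ≤ ∫ |γ̇|^p(t) dλ(γ)` for a.e. `t ∈ [0,T]`. -/
theorem pushforward_curve_ACp_and_speed_bound
    {X : Type*} [MetricSpace X] [CompleteSpace X] [TopologicalSpace.SeparableSpace X]
    [MeasurableSpace X] [BorelSpace X]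
    (T p : ℝ) (hT : 0 < T) (hp : 1 < p) (xb : X)
    [MeasurableSpace C(Icc (0:ℝ) T, X)] [BorelSpace C(Icc (0:ℝ) T, X)]
    (lam : Measure C(Icc (0:ℝ) T, X)) [IsProbabilityMeasure lam]
    (hAC : ∀ᵐ γ ∂lam, IsACpOn 1 T (extendIcc hT.le γ))
    (hen : ∫⁻ γ, (∫⁻ r in Icc (0:ℝ) T,
        ENNReal.ofReal (mSpeed (extendIcc hT.le γ) r ^ p)) ∂lam < ⊤)
    (hmom : ∫⁻ x, edist x xb ^ p ∂(lam.map (fun γ => extendIcc hT.le γ 0)) < ⊤) :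
    ((∀ t ∈ Icc (0:ℝ) T,
        ∫⁻ x, edist x xb ^ p ∂(lam.map (fun γ => extendIcc hT.le γ t)) < ⊤) ∧
      (∃ G : ℝ → ℝ≥0∞, (∫⁻ r in Icc (0:ℝ) T, G r ^ p) < ⊤ ∧
        ∀ ⦃s t : ℝ⦄, s ∈ Icc (0:ℝ) T → t ∈ Icc (0:ℝ) T → s ≤ t →
          Wpp p (lam.map (fun γ => extendIcc hT.le γ s))
              (lam.map (fun γ => extendIcc hT.le γ t))
            ≤ (∫⁻ r in Icc s t, G r) ^ p)) ∧
    (∀ᵐ t ∂(volume.restrict (Icc (0:ℝ) T)),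
      pSpeedW p (fun s => lam.map (fun γ => extendIcc hT.le γ s)) t ≤
        ∫⁻ γ, ENNReal.ofReal (mSpeed (extendIcc hT.le γ) t ^ p) ∂lam) := by
  have hp0 : 0 < p := by linarith
  have : SecondCountableTopology X := UniformSpace.secondCountable_of_separable X
  have : Nonempty X := ⟨xb⟩
  have hev : ∀ t, Measurable fun γ : C(Icc (0:ℝ) T, X) => extendIcc hT.le γ t := fun t =>
    ((continuous_extendIcc hT.le).comp (f := fun γ => (γ, t)) (by fun_prop)).measurable
  have hprob : ∀ t, IsProbabilityMeasure (lam.map fun γ => extendIcc hT.le γ t) := fun t =>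
    Measure.isProbabilityMeasure_map (hev t).aemeasurable
  obtain ⟨S, B, hS, hB, hBS, hBlim⟩ := exists_measurable_mSpeed (X := X) hT.le
  have hSp : Measurable fun z => ENNReal.ofReal (S z) ^ p := by fun_prop
  have hgood : ∀ᵐ γ ∂lam, (∀ᵐ t, (γ, t) ∈ B ∩ {z | 0 ≤ S z}) ∧ ∀ s t, s ≤ t →
      edist (extendIcc hT.le γ s) (extendIcc hT.le γ t) ≤
        ∫⁻ r in Icc s t, ENNReal.ofReal (S (γ, r)) := by
    filter_upwards [hAC] with γ ⟨g, hg0, hgfin, hgd⟩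
    obtain ⟨m, -, hm0, hlim, hDm⟩ := exists_metric_deriv hT.le
      (D := fun s t => dist (extendIcc hT.le γ s) (extendIcc hT.le γ t))
      (g := fun r => ENNReal.ofReal (g r)) (fun s t => dist_nonneg) (fun s t => dist_comm _ _)
      (fun r s t => dist_triangle _ _ _) (fun s t => by simp [extendIcc])
      (by simpa using hgfin.ne)
      (fun s hs t ht hst => by
        refine (ENNReal.ofReal_le_ofReal (hgd hs ht hst)).trans ?_
        by_cases hi : IntegrableOn g (Icc s t)
        · rw [ofReal_integral_eq_lintegral_ofReal hi (ae_of_all _ hg0)]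
        · rw [integral_undef hi]; simp)
    have hmS : ∀ᵐ t, (γ, t) ∈ B ∧ S (γ, t) = m t := by
      filter_upwards [hlim] with t ht
      have hb := hBlim γ t _ ht
      exact ⟨hb, (hBS _ hb).symm.trans ht.limUnder_eq⟩
    refine ⟨?_, fun s t hst => ?_⟩
    · filter_upwards [hmS] with t ht
      refine ⟨ht.1, ?_⟩
      rw [mem_ofPred_eq, ht.2]
      exact hm0 t
    · rw [edist_dist]
      refine (hDm s t hst).trans (le_of_eq (lintegral_congr_ae (ae_restrict_of_ae ?_)))
      filter_upwards [hmS] with t ht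
      rw [ht.2]
  have hspeed : ∀ γ t, (γ, t) ∈ B ∩ {z | 0 ≤ S z} →
      ENNReal.ofReal (mSpeed (extendIcc hT.le γ) t ^ p) = ENNReal.ofReal (S (γ, t)) ^ p := by
    intro γ t h
    rw [hBS _ h.1, ENNReal.ofReal_rpow_of_nonneg h.2 hp0.le]
  have hswap : ∀ᵐ t, ∀ᵐ γ ∂lam, (γ, t) ∈ B ∩ {z | 0 ≤ S z} :=
    (Measure.ae_ae_comm (p := fun γ t => (γ, t) ∈ B ∩ {z | 0 ≤ S z})
      (hB.inter (measurableSet_le measurable_const hS))).1 (hgood.mono fun γ h => h.1)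
  let H : ℝ → ℝ≥0∞ := fun t => ∫⁻ γ, ENNReal.ofReal (S (γ, t)) ^ p ∂lam
  have hH : Measurable H := hSp.lintegral_prod_left'
  have hHA : ∀ s t, ∫⁻ r in Icc s t, H r =
      ∫⁻ γ, (∫⁻ r in Icc s t, ENNReal.ofReal (S (γ, r)) ^ p) ∂lam := fun s t =>
    lintegral_lintegral_swap (f := fun r γ => ENNReal.ofReal (S (γ, r)) ^ p)
      (hSp.comp measurable_swap).aemeasurable
  have hHfin : ∫⁻ r in Icc 0 T, H r ≠ ⊤ := by
    rw [hHA]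
    refine ne_of_eq_of_ne (lintegral_congr_ae ?_) hen.ne
    filter_upwards [hgood] with γ hγ
    refine lintegral_congr_ae (ae_restrict_of_ae ?_)
    filter_upwards [hγ.1] with t ht using (hspeed γ t ht).symm
  have hcost : ∀ s t, s ≤ t →
      ∫⁻ γ, edist (extendIcc hT.le γ s) (extendIcc hT.le γ t) ^ p ∂lam ≤
        ENNReal.ofReal (t - s) ^ (p - 1) * ∫⁻ r in Icc s t, H r := by
    intro s t hst
    rw [hHA, ← lintegral_const_mul' _ _
      (ENNReal.rpow_ne_top_of_nonneg (by linarith) ENNReal.ofReal_ne_top)]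
    refine lintegral_mono_ae ?_
    filter_upwards [hgood] with γ hγ
    exact (ENNReal.rpow_le_rpow (hγ.2 s t hst) hp0.le).trans
      (rpow_setLIntegral_Icc_le hp (by fun_prop) s t)
  have hW : ∀ s ∈ Icc 0 T, ∀ t ∈ Icc 0 T, s ≤ t →
      Wpp p (lam.map fun γ => extendIcc hT.le γ s) (lam.map fun γ => extendIcc hT.le γ t) ≤
        ENNReal.ofReal (t - s) ^ (p - 1) * ∫⁻ r in Icc s t, H r := by
    intro s _ t _ hst
    refine le_trans ?_ (hcost s t hst)
    have hst' := (hev s).prodMk (hev t)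
    refine (iInf₂_le (lam.map fun γ => (extendIcc hT.le γ s, extendIcc hT.le γ t)) ?_).trans
      (le_of_eq ?_)
    · constructor
      · rw [Measure.map_map measurable_fst hst']; rfl
      · rw [Measure.map_map measurable_snd hst']; rfl
    · rw [lintegral_map (by fun_prop) hst']
  obtain ⟨m, hm, hmW⟩ := exists_speed_of_Wpp_le
    (μ := fun t => lam.map fun γ => extendIcc hT.le γ t) hT.le hp
    (fun t => by simp [extendIcc]) hH hHfin hW
  refine ⟨⟨fun t ht => ?_, m, ?_, fun s t hs ht hst => hmW s hs t ht hst⟩, ?_⟩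
  · rw [lintegral_map (by fun_prop) (hev _)] at hmom ⊢
    have hfin : ∫⁻ γ, edist (extendIcc hT.le γ 0) (extendIcc hT.le γ t) ^ p ∂lam < ⊤ := by
      refine (hcost 0 t ht.1).trans_lt (ENNReal.mul_lt_top
        (ENNReal.rpow_lt_top_of_nonneg (by linarith) ENNReal.ofReal_ne_top) ?_)
      exact (lintegral_mono_set (Icc_subset_Icc_right ht.2)).trans_lt hHfin.lt_top
    refine lt_of_le_of_lt (lintegral_mono fun γ => ?_)
      (ENNReal.lintegral_rpow_add_lt_top_of_lintegral_rpow_lt_top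
        ((hev 0).edist (hev t)).aemeasurable hfin hmom hp.le)
    refine ENNReal.rpow_le_rpow ?_ hp0.le
    rw [Pi.add_apply, edist_comm (extendIcc hT.le γ 0) (extendIcc hT.le γ t)]
    exact edist_triangle _ _ _
  · exact (lintegral_mono_ae (hm.mono fun t h => h.1)).trans_lt hHfin.lt_top
  · filter_upwards [hm, ae_restrict_of_ae hswap] with t h1 h2
    rw [h1.2]
    refine h1.1.trans (le_of_eq (lintegral_congr_ae ?_))
    filter_upwards [h2] with γ hγ using (hspeed γ t hγ).symm

end
end

section
/- Let 𝔪₀, 𝔪₁ ∈ P(ℝ^∞) where ℝ^∞ carries the product topology and the metric D_∞(x,y) = sup_n min(|x_n−y_n|,1). Let π^n : ℝ^∞ → ℝ^∞ be the truncation projection π^n(x) = (x₁,…,x_n,0,0,…). Then lim_{n→∞} W_{1,D_∞}(π^n_♯𝔪₀, π^n_♯𝔪₁) = W_{1,D_∞}(𝔪₀,𝔪₁), and consequently the duality formula W_{1,D_∞}(𝔪₀,𝔪₁) = sup{ ∫ F d(𝔪₀−𝔪₁) : F = Ψ∘p^k cylinder function, k ∈ ℕ, Ψ ∈ C¹_c(ℝ^k),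 ‖Ψ‖_∞ ≤ 1/2, ‖Σ_{i=1}^k |∂_iΨ|‖_∞ ≤ 1 } holds. -/
open MeasureTheory Set ENNReal Filter

noncomputable section

/-- The truncated sup metric `D_∞` on `ℝ^∞ = ℕ → ℝ`. -/
def Dinfty (x y : ℕ → ℝ) : ℝ≥0∞ :=
  ⨆ n : ℕ, ENNReal.ofReal (min |x n - y n| 1)

/-- The `1`-Wasserstein distance built from a cost `c`. -/
def Wc {α : Type*} [MeasurableSpace α] (c : α → α → ℝ≥0∞) (μ ν : Measure α) : ℝ≥0∞ :=
  ⨅ π ∈ couplings μ ν, ∫⁻ z : α × α, c z.1 z.2 ∂π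

/-- The truncation projection `π^n(x) = (x₁,…,x_n,0,0,…)`. -/
def trunc (n : ℕ) (x : ℕ → ℝ) : ℕ → ℝ := fun k => if k < n then x k else 0

/-- Hahn–Banach for a convex cone `A ⊆ E × ℝ` of upper bounds. -/
theorem exists_linearMap_le_of_cone {E : Type*} [AddCommGroup E] [Module ℝ E] (A : E → ℝ → Prop)
    (hadd : ∀ x y r s, A x r → A y s → A (x + y) (r + s))
    (hsmul : ∀ c x r, 0 < c → A x r → A (c • x) (c * r))
    (hex : ∀ x, ∃ r, A x r) (hzero : ∀ r, A 0 r → 0 ≤ r) :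
    ∃ L : E →ₗ[ℝ] ℝ, ∀ x r, A x r → L x ≤ r := by
  have hbdd (x : E) : BddBelow {r | A x r} := by
    obtain ⟨s, hs⟩ := hex (-x)
    refine ⟨-s, fun r hr => ?_⟩
    have := hzero (r + s) (by simpa using hadd _ _ _ _ hr hs)
    linarith
  have hN_add (x y : E) : sInf {r | A (x + y) r} ≤ sInf {r | A x r} + sInf {r | A y r} := by
    rw [← sub_le_iff_le_add]
    refine le_csInf (hex x) fun r hr => ?_
    rw [sub_le_iff_le_add', ← sub_le_iff_le_add]
    refine le_csInf (hex y) fun s hs => ?_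
    rw [sub_le_iff_le_add']
    exact csInf_le (hbdd _) (hadd _ _ _ _ hr hs)
  have hN_le (c : ℝ) (hc : 0 < c) (x : E) :
      sInf {r | A (c • x) r} ≤ c * sInf {r | A x r} := by
    rw [← div_le_iff₀' hc]
    refine le_csInf (hex x) fun r hr => ?_
    rw [div_le_iff₀' hc]
    exact csInf_le (hbdd _) (hsmul _ _ _ hc hr)
  have hN_smul (c : ℝ) (hc : 0 < c) (x : E) :
      sInf {r | A (c • x) r} = c * sInf {r | A x r} := by
    refine le_antisymm (hN_le c hc x) ?_
    have h := hN_le c⁻¹ (inv_pos.2 hc) (c • x)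
    rw [inv_smul_smul₀ hc.ne'] at h
    rwa [← le_inv_mul_iff₀ hc]
  obtain ⟨L, -, hL⟩ := exists_extension_of_le_sublinear (E := E) ⟨⊥, 0⟩ (fun x => sInf {r | A x r})
    hN_smul hN_add (by
      rintro ⟨x, hx⟩
      obtain rfl : x = 0 := by simpa using hx
      exact le_csInf (hex 0) fun r hr => by simpa using hzero r hr)
  exact ⟨L, fun x r hr => (hL x).trans (csInf_le (hbdd x) hr)⟩

open scoped CompactlySupported in
/-- Riesz representation on a compact space for a positive functional on `C(X, ℝ)`. -/
theorem exists_measure_integral_eq_of_nonneg {X : Type*} [TopologicalSpace X] [T2Space X]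
    [CompactSpace X] [MeasurableSpace X] [BorelSpace X] (L : C(X, ℝ) →ₗ[ℝ] ℝ)
    (hL : ∀ g : C(X, ℝ), 0 ≤ g → 0 ≤ L g) :
    ∃ π : Measure X, IsFiniteMeasure π ∧ ∀ g : C(X, ℝ), ∫ x, g x ∂π = L g := by
  let Λ : C_c(X, ℝ) →ₚ[ℝ] ℝ :=
    { toFun g := L g.toContinuousMap
      map_add' g g' := by rw [← map_add]; rfl
      map_smul' c g := by rw [RingHom.id_apply, ← map_smul]; rfl
      monotone' g g' h := by
        have := hL (g'.toContinuousMap - g.toContinuousMap) fun x => sub_nonneg.2 (h x)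
        simpa using this }
  refine ⟨RealRMK.rieszMeasure Λ, inferInstance, fun g => ?_⟩
  exact RealRMK.integral_rieszMeasure Λ ⟨g, HasCompactSupport.of_compactSpace _⟩

/-- A bound for the difference of the integrals of all functions which are Lipschitz for a
bounded continuous pseudometric `c` forces the dual constraint to have nonnegative value. -/
theorem nonneg_of_forall_nonneg_add_add {K : Type*} [TopologicalSpace K] [CompactSpace K]
    [MeasurableSpace K] [BorelSpace K] (μ ν : Measure K) [IsProbabilityMeasure μ]
    [IsProbabilityMeasure ν] (c : C(K × K, ℝ))
    (hc_self : ∀ x, c (x, x) = 0) (hc_tri : ∀ x y z, c (x, z) ≤ c (x, y) + c (y, z))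
    (S : ℝ) (hS : ∀ f : C(K, ℝ), (∀ x y, f x - f y ≤ c (x, y)) → ∫ x, f x ∂μ - ∫ x, f x ∂ν ≤ S)
    (φ ψ : C(K, ℝ)) (t : ℝ) (ht : 0 ≤ t) (h : ∀ x y, 0 ≤ φ x + ψ y + t * c (x, y)) :
    0 ≤ ∫ x, φ x ∂μ + ∫ x, ψ x ∂ν + t * S := by
  have hinteg (f : C(K, ℝ)) (m : Measure K) [IsFiniteMeasure m] : Integrable f m :=
    f.continuous.integrable_of_hasCompactSupport (HasCompactSupport.of_compactSpace _)
  have : Nonempty K := by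
    by_contra hK
    rw [not_nonempty_iff] at hK
    exact IsProbabilityMeasure.ne_zero μ (Measure.eq_zero_of_isEmpty μ)
  have hbdd (x : K) : BddBelow (range fun y => ψ y + t * c (x, y)) :=
    ⟨-φ x, by rintro _ ⟨y, rfl⟩; linarith [h x y]⟩
  let f : K → ℝ := fun x => ⨅ y, ψ y + t * c (x, y)
  have hf_lip (x y : K) : f x - f y ≤ t * c (x, y) := by
    rw [sub_le_comm]
    refine le_ciInf fun z => ?_
    have h1 : f x ≤ ψ z + t * c (x, z) := ciInf_le (hbdd x) z
    have h2 := mul_le_mul_of_nonneg_left (hc_tri x y z) ht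
    linarith
  have hf_cont : Continuous f := by
    rw [continuous_iff_continuousAt]
    intro x
    have h1 : Tendsto (fun y => t * c (y, x)) (nhds x) (nhds 0) := by
      have : Continuous fun y => t * c (y, x) := by fun_prop
      simpa [hc_self] using this.tendsto x
    have h2 : Tendsto (fun y => t * c (x, y)) (nhds x) (nhds 0) := by
      have : Continuous fun y => t * c (x, y) := by fun_prop
      simpa [hc_self] using this.tendsto x
    refine tendsto_order.2 ⟨fun a ha => ?_, fun a ha => ?_⟩
    · filter_upwards [h2.eventually_lt_const (sub_pos.2 ha)] with y hy
      linarith [hf_lip x y]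
    · filter_upwards [h1.eventually_lt_const (sub_pos.2 ha)] with y hy
      linarith [hf_lip y x]
  have hφ (x : K) : -φ x ≤ f x := le_ciInf fun y => by linarith [h x y]
  have hψ (x : K) : f x ≤ ψ x := by simpa [hc_self] using ciInf_le (hbdd x) x
  have hfS : ∫ x, f x ∂μ - ∫ x, f x ∂ν ≤ t * S := by
    rcases ht.eq_or_lt with rfl | ht
    · obtain ⟨x₀⟩ := this
      have hconst (x : K) : f x = f x₀ := by
        have h1 := hf_lip x x₀
        have h2 := hf_lip x₀ x
        linarith
      simp [hconst]
    · have := hS ⟨fun x => t⁻¹ * f x, by fun_prop⟩ fun x y => by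
        simp only [ContinuousMap.coe_mk]
        rw [← mul_sub, inv_mul_le_iff₀ ht]
        exact hf_lip x y
      simp only [ContinuousMap.coe_mk, integral_const_mul] at this
      rwa [← mul_sub, inv_mul_le_iff₀ ht] at this
  have h1 : -∫ x, φ x ∂μ ≤ ∫ x, f x ∂μ := by
    rw [← integral_neg]
    exact integral_mono (hinteg φ μ).neg (hinteg ⟨f, hf_cont⟩ μ) hφ
  have h2 : ∫ x, f x ∂ν ≤ ∫ x, ψ x ∂ν :=
    integral_mono (hinteg ⟨f, hf_cont⟩ ν) (hinteg ψ ν) hψ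
  linarith

/-- **Kantorovich–Rubinstein duality** for a continuous pseudometric on a compact space. -/
theorem exists_coupling_integral_le {K : Type*} [TopologicalSpace K] [CompactSpace K] [T2Space K]
    [SecondCountableTopology K] [MeasurableSpace K] [BorelSpace K] (μ ν : Measure K)
    [IsProbabilityMeasure μ] [IsProbabilityMeasure ν] (c : C(K × K, ℝ))
    (hc_self : ∀ x, c (x, x) = 0) (hc_tri : ∀ x y z, c (x, z) ≤ c (x, y) + c (y, z))
    (S : ℝ)
    (hS : ∀ f : C(K, ℝ), (∀ x y, f x - f y ≤ c (x, y)) → ∫ x, f x ∂μ - ∫ x, f x ∂ν ≤ S) :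
    ∃ π : Measure (K × K), π.map Prod.fst = μ ∧ π.map Prod.snd = ν ∧ ∫ z, c z ∂π ≤ S := by
  have hinteg (f : C(K, ℝ)) (m : Measure K) [IsFiniteMeasure m] : Integrable f m :=
    f.continuous.integrable_of_hasCompactSupport (HasCompactSupport.of_compactSpace _)
  let A : C(K × K, ℝ) → ℝ → Prop := fun h r => ∃ (φ ψ : C(K, ℝ)) (t : ℝ), 0 ≤ t ∧
    (∀ x y, h (x, y) ≤ φ x + ψ y + t * c (x, y)) ∧ r = ∫ x, φ x ∂μ + ∫ x, ψ x ∂ν + t * S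
  obtain ⟨L, hL⟩ := exists_linearMap_le_of_cone A
    (by
      rintro h h' _ _ ⟨φ, ψ, t, ht, hle, rfl⟩ ⟨φ', ψ', t', ht', hle', rfl⟩
      refine ⟨φ + φ', ψ + ψ', t + t', add_nonneg ht ht', fun x y => ?_, ?_⟩
      · simp only [ContinuousMap.add_apply]
        linarith [hle x y, hle' x y]
      · simp only [ContinuousMap.add_apply]
        rw [integral_add (hinteg φ μ) (hinteg φ' μ), integral_add (hinteg ψ ν) (hinteg ψ' ν)]
        ring)
    (by
      rintro a h _ ha ⟨φ, ψ, t, ht, hle, rfl⟩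
      refine ⟨a • φ, a • ψ, a * t, by positivity, fun x y => ?_, ?_⟩
      · have := mul_le_mul_of_nonneg_left (hle x y) ha.le
        simp only [ContinuousMap.smul_apply, smul_eq_mul]
        linarith
      · simp only [ContinuousMap.smul_apply, smul_eq_mul, integral_const_mul]
        ring)
    (fun h => ⟨_, ContinuousMap.const K ‖h‖, 0, 0, le_rfl, fun x y => by
      simpa using (le_abs_self _).trans (h.norm_coe_le_norm (x, y)), rfl⟩)
    (by
      rintro _ ⟨φ, ψ, t, ht, hle, rfl⟩
      exact nonneg_of_forall_nonneg_add_add μ ν c hc_self hc_tri S hS φ ψ t ht hle)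
  have hL_nonneg (g : C(K × K, ℝ)) (hg : 0 ≤ g) : 0 ≤ L g := by
    have := hL (-g) 0 ⟨0, 0, 0, le_rfl, fun x y => by simpa using hg (x, y), by simp⟩
    simpa using this
  obtain ⟨π, hπ, hπL⟩ := exists_measure_integral_eq_of_nonneg L hL_nonneg
  have heq (g : C(K × K, ℝ)) (r : ℝ) (h₁ : A g r) (h₂ : A (-g) (-r)) : L g = r := by
    have h := hL _ _ h₂
    rw [map_neg] at h
    exact le_antisymm (hL _ _ h₁) (by linarith)
  refine ⟨π, ?_, ?_, ?_⟩
  · refine ext_of_forall_integral_eq_of_IsFiniteMeasure fun f => ?_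
    rw [integral_map (by fun_prop) (by fun_prop)]
    refine (hπL ((f : C(K, ℝ)).comp ⟨Prod.fst, by fun_prop⟩)).trans (heq _ _
      ⟨f, 0, 0, le_rfl, by simp, by simp⟩ ⟨-f, 0, 0, le_rfl, by simp, by simp [integral_neg]⟩)
  · refine ext_of_forall_integral_eq_of_IsFiniteMeasure fun f => ?_
    rw [integral_map (by fun_prop) (by fun_prop)]
    refine (hπL ((f : C(K, ℝ)).comp ⟨Prod.snd, by fun_prop⟩)).trans (heq _ _
      ⟨0, f, 0, le_rfl, by simp, by simp⟩ ⟨0, -f, 0, le_rfl, by simp, by simp [integral_neg]⟩)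
  · rw [hπL]
    exact hL c S ⟨0, 0, 1, zero_le_one, by simp, by simp⟩

theorem sum_abs_fderiv_single_le_one_of_lipschitzWith {k : ℕ} {Ψ : (Fin k → ℝ) → ℝ}
    (h : LipschitzWith 1 Ψ) (y : Fin k → ℝ) :
    ∑ i : Fin k, |fderiv ℝ Ψ y (Pi.single i 1)| ≤ 1 := by
  let v : Fin k → ℝ := fun i => SignType.sign (fderiv ℝ Ψ y (Pi.single i 1))
  have hv : ‖v‖ ≤ 1 := by
    refine (pi_norm_le_iff_of_nonneg zero_le_one).2 fun i => ?_
    rcases SignType.trichotomy (SignType.sign (fderiv ℝ Ψ y (Pi.single i 1))) with h | h | h <;>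
      simp [v, h]
  have hsum : ∑ i : Fin k, |fderiv ℝ Ψ y (Pi.single i 1)| = fderiv ℝ Ψ y v := by
    conv_rhs => rw [pi_eq_sum_univ' v]
    simp only [map_sum, map_smul, smul_eq_mul, v]
    refine Finset.sum_congr rfl fun i _ => ?_
    rw [sign_mul_self]
  rw [hsum]
  calc fderiv ℝ Ψ y v ≤ ‖fderiv ℝ Ψ y v‖ := le_abs_self _
    _ ≤ ‖fderiv ℝ Ψ y‖ * ‖v‖ := ContinuousLinearMap.le_opNorm _ _
    _ ≤ 1 * 1 := by
      gcongr
      simpa using norm_fderiv_le_of_lipschitz ℝ (x₀ := y) h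
    _ = 1 := one_mul 1

theorem lipschitzWith_one_of_sum_abs_fderiv_single_le_one {k : ℕ} {Ψ : (Fin k → ℝ) → ℝ}
    (hd : ContDiff ℝ 1 Ψ) (h : ∀ y, ∑ i : Fin k, |fderiv ℝ Ψ y (Pi.single i 1)| ≤ 1) :
    LipschitzWith 1 Ψ := by
  refine lipschitzWith_of_nnnorm_fderiv_le (𝕜 := ℝ) (hd.differentiable one_ne_zero) fun y => ?_
  rw [← NNReal.coe_le_coe]
  refine ContinuousLinearMap.opNorm_le_bound _ zero_le_one fun v => ?_
  conv_lhs => rw [pi_eq_sum_univ' v]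
  simp only [map_sum, map_smul, smul_eq_mul]
  calc ‖∑ i, v i * fderiv ℝ Ψ y (Pi.single i 1)‖
      ≤ ∑ i, ‖v‖ * |fderiv ℝ Ψ y (Pi.single i 1)| := by
        refine norm_sum_le_of_le _ fun i _ => ?_
        rw [norm_mul, Real.norm_eq_abs (fderiv ℝ Ψ y _)]
        gcongr
        exact norm_le_pi_norm v i
    _ ≤ 1 * ‖v‖ := by
        rw [← Finset.mul_sum, mul_comm]
        gcongr
        exact h y

open scoped Convolution in
/-- Mollification of a bounded `1`-Lipschitz function with compact support. -/
theorem exists_contDiff_lipschitzWith_one_approx {E : Type*} [NormedAddCommGroup E]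
    [NormedSpace ℝ E] [FiniteDimensional ℝ E] {g : E → ℝ} {b ε : ℝ}
    (hg : LipschitzWith 1 g) (hgs : HasCompactSupport g) (hgb : ∀ x, |g x| ≤ b) (hε : 0 < ε) :
    ∃ Ψ : E → ℝ, ContDiff ℝ 1 Ψ ∧ HasCompactSupport Ψ ∧ (∀ x, |Ψ x| ≤ b) ∧ LipschitzWith 1 Ψ ∧
      ∀ x, |Ψ x - g x| ≤ ε := by
  borelize E
  let m : Measure E := Measure.addHaar
  let φ : ContDiffBump (0 : E) := ⟨ε / 2, ε, half_pos hε, half_lt_self hε⟩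
  have hinteg (x : E) : Integrable (fun t => φ.normed m t * g (x - t)) m := by
    refine Continuous.integrable_of_hasCompactSupport ?_ φ.hasCompactSupport_normed.mul_right
    exact φ.continuous_normed.mul (hg.continuous.comp (by fun_prop))
  have hbound (C : ℝ) (u : E → ℝ) (hu : ∀ t, |u t| ≤ C) :
      |∫ t, φ.normed m t * u t ∂m| ≤ C := by
    have := norm_integral_le_of_norm_le (μ := m) (f := fun t => φ.normed m t * u t)
      (g := fun t => φ.normed m t * C) (φ.integrable_normed.mul_const C) (ae_of_all _ fun t => by
        rw [norm_mul, Real.norm_of_nonneg (φ.nonneg_normed t)]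
        exact mul_le_mul_of_nonneg_left (hu t) (φ.nonneg_normed t))
    rwa [integral_mul_const, φ.integral_normed, one_mul] at this
  have hconv (x : E) : (φ.normed m ⋆[ContinuousLinearMap.lsmul ℝ ℝ, m] g) x =
      ∫ t, φ.normed m t * g (x - t) ∂m := rfl
  refine ⟨φ.normed m ⋆[ContinuousLinearMap.lsmul ℝ ℝ, m] g, ?_, ?_, fun x => ?_, ?_, fun x => ?_⟩
  · exact φ.hasCompactSupport_normed.contDiff_convolution_left _ φ.contDiff_normed
      hg.continuous.locallyIntegrable
  · exact φ.hasCompactSupport_normed.convolution _ hgs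
  · rw [hconv]
    exact hbound b _ fun t => hgb _
  · refine LipschitzWith.of_dist_le_mul fun x y => ?_
    rw [Real.dist_eq, hconv, hconv, ← integral_sub (hinteg x) (hinteg y)]
    simp only [← mul_sub]
    refine hbound _ _ fun t => ?_
    rw [← Real.dist_eq]
    simpa using hg.dist_le_mul (x - t) (y - t)
  · rw [← Real.dist_eq]
    refine φ.dist_normed_convolution_le hg.continuous.aestronglyMeasurable fun y hy => ?_
    refine (hg.dist_le_mul y x).trans ?_
    rw [NNReal.coe_one, one_mul]
    exact (Metric.mem_ball.1 hy).le

/-- Any bound on `∫ Ψ dμ - ∫ Ψ dν` for compactly supported `C¹` functions extends to bounded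
`1`-Lipschitz functions. -/
theorem integral_sub_integral_le_of_forall_contDiff {E : Type*} [NormedAddCommGroup E]
    [NormedSpace ℝ E] [FiniteDimensional ℝ E] [MeasurableSpace E] [BorelSpace E]
    (μ ν : Measure E) [IsProbabilityMeasure μ] [IsProbabilityMeasure ν] {b S : ℝ}
    (hS : ∀ Ψ : E → ℝ, ContDiff ℝ 1 Ψ → HasCompactSupport Ψ → (∀ x, |Ψ x| ≤ b) →
      LipschitzWith 1 Ψ → ∫ x, Ψ x ∂μ - ∫ x, Ψ x ∂ν ≤ S)
    {g : E → ℝ} (hg : LipschitzWith 1 g) (hgb : ∀ x, |g x| ≤ b) :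
    ∫ x, g x ∂μ - ∫ x, g x ∂ν ≤ S := by
  have hinteg (f : E → ℝ) (hf : Continuous f) (hfb : ∀ x, |f x| ≤ b) (m : Measure E)
      [IsFiniteMeasure m] : Integrable f m :=
    Integrable.of_bound hf.aestronglyMeasurable b (ae_of_all _ hfb)
  have hcs (f : E → ℝ) (hf : LipschitzWith 1 f) (hfs : HasCompactSupport f)
      (hfb : ∀ x, |f x| ≤ b) : ∫ x, f x ∂μ - ∫ x, f x ∂ν ≤ S := by
    refine le_of_forall_pos_le_add fun ε hε => ?_
    obtain ⟨Ψ, hd, hs, hb, hL, happ⟩ :=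
      exists_contDiff_lipschitzWith_one_approx hf hfs hfb (half_pos hε)
    have hdist (m : Measure E) [IsProbabilityMeasure m] :
        |∫ x, Ψ x ∂m - ∫ x, f x ∂m| ≤ ε / 2 := by
      rw [← integral_sub (hinteg Ψ hd.continuous hb m) (hinteg f hf.continuous hfb m)]
      simpa using norm_integral_le_of_norm_le_const (μ := m) (f := fun x => Ψ x - f x)
        (C := ε / 2) (ae_of_all _ happ)
    linarith [hS Ψ hd hs hb hL, (abs_le.1 (hdist μ)).1, (abs_le.1 (hdist ν)).2]
  let w : ℕ → E → ℝ := fun R x => max 0 (R - ‖x‖)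
  have hw (R : ℕ) : LipschitzWith 1 (w R) := by
    have := (LipschitzWith.const (α := E) (R : ℝ)).sub lipschitzWith_one_norm
    rw [zero_add] at this
    exact this.const_max 0
  let f : ℕ → E → ℝ := fun R x => max (-w R x) (min (g x) (w R x))
  have hw0 (R : ℕ) (x : E) : 0 ≤ w R x := le_max_left _ _
  have hb0 : 0 ≤ b := (abs_nonneg _).trans (hgb 0)
  have hf (R : ℕ) : LipschitzWith 1 (f R) := by
    simpa using (hw R).neg.max (hg.min (hw R))
  have hfb (R : ℕ) (x : E) : |f R x| ≤ b := by
    have := abs_le.1 (hgb x)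
    have := hw0 R x
    simp only [f]
    rw [abs_le]
    constructor
    · rw [le_max_iff, le_min_iff]
      by_cases h : -b ≤ -w R x
      · exact .inl h
      · exact .inr ⟨by linarith, by linarith⟩
    · exact max_le (by linarith) ((min_le_left _ _).trans (by linarith))
  have hfs (R : ℕ) : HasCompactSupport (f R) := by
    refine HasCompactSupport.intro (isCompact_closedBall (0 : E) R) fun x hx => ?_
    have hx' : w R x = 0 := by
      rw [mem_closedBall_zero_iff, not_le] at hx
      exact max_eq_left (by linarith)
    simp [f, hx']
  have hlim (x : E) : ∀ᶠ R : ℕ in atTop, f R x = g x := by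
    filter_upwards [eventually_ge_atTop ⌈‖x‖ + b⌉₊] with R hR
    have h1 : b ≤ w R x := le_max_of_le_right (by linarith [Nat.ceil_le.1 hR])
    have := abs_le.1 (hgb x)
    simp only [f]
    rw [min_eq_left (by linarith), max_eq_right (by linarith)]
  have htend (m : Measure E) [IsProbabilityMeasure m] :
      Tendsto (fun R => ∫ x, f R x ∂m) atTop (nhds (∫ x, g x ∂m)) :=
    tendsto_integral_of_dominated_convergence (fun _ => b)
      (fun R => (hf R).continuous.aestronglyMeasurable) (integrable_const b)
      (fun R => ae_of_all _ (hfb R))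
      (ae_of_all _ fun x => tendsto_const_nhds.congr' ((hlim x).mono fun _ h => h.symm))
  exact le_of_tendsto' ((htend μ).sub (htend ν)) fun R => hcs _ (hf R) (hfs R) (hfb R)

theorem measurable_trunc (n : ℕ) : Measurable (trunc n) := by
  refine measurable_pi_lambda _ fun k => ?_
  by_cases h : k < n <;> simp only [trunc, h, if_true, if_false] <;> fun_prop

theorem Dinfty_trunc_le (n : ℕ) (x y : ℕ → ℝ) : Dinfty (trunc n x) (trunc n y) ≤ Dinfty x y := by
  refine iSup_le fun k => ?_
  by_cases h : k < n
  · simp only [trunc, h, if_true]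
    exact le_iSup (fun k => ENNReal.ofReal (min |x k - y k| 1)) k
  · simp [trunc, h]

theorem Wc_Dinfty_map_trunc_le (m₀ m₁ : Measure (ℕ → ℝ)) (n : ℕ) :
    Wc Dinfty (m₀.map (trunc n)) (m₁.map (trunc n)) ≤ Wc Dinfty m₀ m₁ := by
  have hT := measurable_trunc n
  refine le_iInf₂ fun π hπ => ?_
  obtain ⟨rfl, rfl⟩ := hπ
  refine (iInf₂_le (π.map (Prod.map (trunc n) (trunc n))) ⟨?_, ?_⟩).trans
    ((lintegral_map_le _ _).trans (lintegral_mono fun z => Dinfty_trunc_le n z.1 z.2))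
  · rw [Measure.map_map measurable_fst (hT.prodMap hT), Measure.map_map hT measurable_fst]
    rfl
  · rw [Measure.map_map measurable_snd (hT.prodMap hT), Measure.map_map hT measurable_snd]
    rfl

theorem ofReal_min_dist_one_le_Dinfty (k : ℕ) (x y : ℕ → ℝ) :
    ENNReal.ofReal (min (dist (fun i : Fin k => x i) (fun i : Fin k => y i)) 1) ≤ Dinfty x y := by
  have hle : Dinfty x y ≤ 1 := iSup_le fun n => by simp
  have hne : Dinfty x y ≠ ∞ := ne_top_of_le_ne_top one_ne_top hle
  refine ofReal_le_of_le_toReal ?_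
  by_cases h1 : 1 ≤ (Dinfty x y).toReal
  · exact (min_le_right _ _).trans h1
  · refine min_le_of_left_le ((dist_pi_le_iff toReal_nonneg).2 fun i => ?_)
    have h : min |x i - y i| 1 ≤ (Dinfty x y).toReal :=
      (ofReal_le_iff_le_toReal hne).1 (le_iSup (fun n => ENNReal.ofReal (min |x n - y n| 1)) _)
    exact (min_le_iff.1 h).resolve_right h1

/-- Weak duality: an integral difference against a cylinder function is at most the cost. -/
theorem ofReal_integral_sub_integral_le_Wc (m₀ m₁ : Measure (ℕ → ℝ)) [IsProbabilityMeasure m₀]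
    [IsProbabilityMeasure m₁] {k : ℕ} {Ψ : (Fin k → ℝ) → ℝ} (hL : LipschitzWith 1 Ψ)
    (hb : ∀ y, |Ψ y| ≤ 1 / 2) :
    ENNReal.ofReal ((∫ x, Ψ (fun i : Fin k => x i) ∂m₀) - ∫ x, Ψ (fun i : Fin k => x i) ∂m₁) ≤
      Wc Dinfty m₀ m₁ := by
  refine le_iInf₂ fun π hπ => ?_
  obtain ⟨h₀, h₁⟩ := hπ
  have : IsProbabilityMeasure π := by
    have : IsProbabilityMeasure (π.map Prod.fst) := h₀ ▸ ‹_›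
    exact Measure.isProbabilityMeasure_of_map (μ := π) Prod.fst
  let F : (ℕ → ℝ) → ℝ := fun x => Ψ fun i : Fin k => x i
  have hF : Continuous F := hL.continuous.comp (by fun_prop)
  have hinteg {g : (ℕ → ℝ) × (ℕ → ℝ) → ℕ → ℝ} (hg : Continuous g) :
      Integrable (fun z => F (g z)) π :=
    Integrable.of_bound (hF.comp hg).aestronglyMeasurable (1 / 2) (ae_of_all _ fun z => hb _)
  have heq : (∫ x, F x ∂m₀) - ∫ x, F x ∂m₁ = ∫ z, (F z.1 - F z.2) ∂π := by
    rw [integral_sub (hinteg continuous_fst) (hinteg continuous_snd), ← h₀, ← h₁,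
      integral_map (by fun_prop) (by fun_prop), integral_map (by fun_prop) (by fun_prop)]
  calc ENNReal.ofReal ((∫ x, F x ∂m₀) - ∫ x, F x ∂m₁)
      ≤ ENNReal.ofReal (∫ z, max (F z.1 - F z.2) 0 ∂π) := by
        have hd := (hinteg continuous_fst).sub (hinteg continuous_snd)
        rw [heq]
        exact ofReal_le_ofReal (integral_mono hd hd.pos_part fun z => le_max_left _ _)
    _ = ∫⁻ z, ENNReal.ofReal (max (F z.1 - F z.2) 0) ∂π :=
        ofReal_integral_eq_lintegral_ofReal
          ((hinteg continuous_fst).sub (hinteg continuous_snd)).pos_part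
          (ae_of_all _ fun z => le_max_right _ _)
    _ ≤ ∫⁻ z, Dinfty z.1 z.2 ∂π := by
        refine lintegral_mono fun z => ?_
        refine le_trans (ofReal_le_ofReal ?_) (ofReal_min_dist_one_le_Dinfty k z.1 z.2)
        refine max_le (le_min ?_ ?_) (le_min dist_nonneg zero_le_one)
        · refine (le_abs_self _).trans ?_
          simpa [Real.dist_eq] using
            hL.dist_le_mul (fun i : Fin k => z.1 i) (fun i : Fin k => z.2 i)
        · have h1 := (abs_le.1 (hb fun i : Fin k => z.1 i)).2
          have h2 := (abs_le.1 (hb fun i : Fin k => z.2 i)).1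
          simp only [F]
          linarith

/-- The truncation of an extended real number to the interval `[-n, n]`. -/
def clip (n : ℕ) (a : EReal) : ℝ := (max (-(n : ℝ) : ℝ) (min (n : ℝ) a) : EReal).toReal

theorem clip_coe (n : ℕ) (x : ℝ) : clip n x = max (-(n : ℝ)) (min n x) := by
  have h := EReal.coe_strictMono.monotone
  rw [clip, ← h.map_min, ← h.map_max, EReal.toReal_coe]

theorem clip_of_abs_le {n : ℕ} {x : ℝ} (h : |x| ≤ n) : clip n x = x := by
  rw [clip_coe, min_eq_right (abs_le.1 h).2, max_eq_right (abs_le.1 h).1]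

theorem continuous_clip (n : ℕ) : Continuous (clip n) := by
  refine EReal.continuousOn_toReal.comp_continuous (by fun_prop) fun a => ?_
  simp only [mem_compl_iff, mem_insert_iff, mem_singleton_iff, not_or]
  constructor
  · exact ((EReal.bot_lt_coe _).trans_le (le_max_left _ _)).ne'
  · exact (max_lt (EReal.coe_lt_top _) ((min_le_left _ _).trans_lt (EReal.coe_lt_top _))).ne

theorem clip_eq_clip_clip {n m : ℕ} (h : n ≤ m) (a : EReal) : clip n a = clip n (clip m a) := by
  have h' : (n : ℝ) ≤ m := by exact_mod_cast h
  have hn : (0 : ℝ) ≤ n := n.cast_nonneg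
  induction a with
  | bot =>
    have (l : ℕ) : clip l ⊥ = -l := by
      rw [clip, min_eq_right bot_le, max_eq_left bot_le, EReal.toReal_coe]
    rw [clip_coe, this, this, min_eq_right (by linarith), max_eq_left (by linarith)]
  | top =>
    have (l : ℕ) : clip l ⊤ = l := by
      have hl : (0 : ℝ) ≤ l := l.cast_nonneg
      rw [clip, min_eq_left le_top, ← EReal.coe_strictMono.monotone.map_max, EReal.toReal_coe,
        max_eq_right (by linarith)]
    rw [clip_coe, this, this, min_eq_left h', max_eq_right (by linarith)]
  | coe x =>
    simp only [clip_coe]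
    grind

theorem abs_clip_coe_sub_clip_coe_le (n : ℕ) (x y : ℝ) :
    |clip n (x : EReal) - clip n (y : EReal)| ≤ |x - y| := by
  simp only [clip_coe]
  grind

/-- The first `n` coordinates, each truncated to `[-n, n]`. -/
def clipPi (n : ℕ) (a : ℕ → EReal) : Fin n → ℝ := fun j => clip n (a j)

theorem continuous_clipPi (n : ℕ) : Continuous (clipPi n) :=
  continuous_pi fun _ => (continuous_clip n).comp (continuous_apply _)

theorem dist_clipPi_mono {n m : ℕ} (h : n ≤ m) (a b : ℕ → EReal) :
    dist (clipPi n a) (clipPi n b) ≤ dist (clipPi m a) (clipPi m b) := by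
  refine (dist_pi_le_iff dist_nonneg).2 fun j => ?_
  simp only [clipPi]
  rw [clip_eq_clip_clip h (a j), clip_eq_clip_clip h (b j)]
  exact (abs_clip_coe_sub_clip_coe_le n _ _).trans
    (dist_le_pi_dist (clipPi m a) (clipPi m b) (Fin.castLE h j))

/-- A continuous pseudometric on the compactification `ℕ → EReal` of `ℕ → ℝ`. -/
def clipCost (n : ℕ) : C((ℕ → EReal) × (ℕ → EReal), ℝ) where
  toFun z := min (dist (clipPi n z.1) (clipPi n z.2)) 1
  continuous_toFun := by
    have := continuous_clipPi n
    fun_prop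

theorem Dinfty_le_iSup_clipCost (x y : ℕ → ℝ) :
    Dinfty x y ≤
      ⨆ n, ENNReal.ofReal (clipCost n (fun j => (x j : EReal), fun j => (y j : EReal))) := by
  refine iSup_le fun j => ?_
  obtain ⟨n, hn⟩ := exists_nat_ge (max |x j| (max |y j| (j + 1)))
  have hx : |x j| ≤ n := (le_max_left _ _).trans hn
  have hy : |y j| ≤ n := (le_max_left _ _).trans ((le_max_right _ _).trans hn)
  have hj : j < n := by
    have : (j + 1 : ℝ) ≤ n := (le_max_right _ _).trans ((le_max_right _ _).trans hn)
    exact_mod_cast this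
  refine le_iSup_of_le n (ofReal_le_ofReal (min_le_min_right 1 ?_))
  have := dist_le_pi_dist (clipPi n fun j => (x j : EReal)) (clipPi n fun j => (y j : EReal))
    ⟨j, hj⟩
  simpa [clipPi, clip_of_abs_le hx, clip_of_abs_le hy, Real.dist_eq] using this

/-- A family of couplings on the compactification which are almost optimal for each `clipCost`
yields a single coupling for `Dinfty`. -/
theorem Wc_Dinfty_le_of_forall_coupling (m₀ m₁ : Measure (ℕ → ℝ)) [IsProbabilityMeasure m₀]
    [IsProbabilityMeasure m₁] (S : ℝ)
    (h : ∀ n, ∃ π : Measure ((ℕ → EReal) × (ℕ → EReal)),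
      π.map Prod.fst = m₀.map (fun x j => (x j : EReal)) ∧
      π.map Prod.snd = m₁.map (fun x j => (x j : EReal)) ∧ ∫ z, clipCost n z ∂π ≤ S) :
    Wc Dinfty m₀ m₁ ≤ ENNReal.ofReal S := by
  let e : (ℕ → ℝ) → ℕ → EReal := fun x j => (x j : EReal)
  have he : Measurable e := measurable_pi_lambda _ fun j => (measurable_pi_apply j).coe_real_ereal
  let p : (ℕ → EReal) → ℕ → ℝ := fun a j => (a j).toReal
  have hp : Measurable p := measurable_pi_lambda _ fun j => (measurable_pi_apply j).ereal_toReal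
  have hpe : p ∘ e = id := by ext x j; simp [p, e]
  let M₀ : ProbabilityMeasure (ℕ → EReal) :=
    ⟨m₀.map e, Measure.isProbabilityMeasure_map he.aemeasurable⟩
  let M₁ : ProbabilityMeasure (ℕ → EReal) :=
    ⟨m₁.map e, Measure.isProbabilityMeasure_map he.aemeasurable⟩
  let C : ℕ → Set (ProbabilityMeasure ((ℕ → EReal) × (ℕ → EReal))) := fun n =>
    {π | π.map measurable_fst.aemeasurable = M₀} ∩ {π | π.map measurable_snd.aemeasurable = M₁} ∩
      {π | ∫ z, clipCost n z ∂π.toMeasure ≤ S}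
  have hclosed (n : ℕ) : IsClosed (C n) := by
    refine ((isClosed_singleton.preimage ?_).inter (isClosed_singleton.preimage ?_)).inter
      (isClosed_le ?_ continuous_const)
    · exact ProbabilityMeasure.continuous_map continuous_fst
    · exact ProbabilityMeasure.continuous_map continuous_snd
    · exact ProbabilityMeasure.continuous_integral_continuousMap (clipCost n)
  have hinteg (n : ℕ) (π : Measure ((ℕ → EReal) × (ℕ → EReal))) [IsFiniteMeasure π] :
      Integrable (clipCost n) π :=
    (clipCost n).continuous.integrable_of_hasCompactSupport (HasCompactSupport.of_compactSpace _)
  have hmono (z : (ℕ → EReal) × (ℕ → EReal)) : Monotone fun n => clipCost n z := fun n m hnm =>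
    min_le_min_right 1 (dist_clipPi_mono hnm z.1 z.2)
  have hne : (⋂ n, C n).Nonempty := by
    refine IsCompact.nonempty_iInter_of_sequence_nonempty_isCompact_isClosed C ?_ ?_
      (hclosed 0).isCompact hclosed
    · exact fun n π hπ => ⟨hπ.1, (integral_mono (hinteg _ _) (hinteg _ _)
        fun z => hmono z n.le_succ).trans hπ.2⟩
    · intro n
      obtain ⟨π, h₀, h₁, hS⟩ := h n
      have : IsProbabilityMeasure π := by
        have : IsProbabilityMeasure (π.map Prod.fst) := h₀ ▸ M₀.2
        exact Measure.isProbabilityMeasure_of_map (μ := π) Prod.fst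
      exact ⟨⟨π, this⟩, ⟨Subtype.ext h₀, Subtype.ext h₁⟩, hS⟩
  obtain ⟨π, hπ⟩ := hne
  rw [mem_iInter] at hπ
  have h₀ : π.toMeasure.map Prod.fst = m₀.map e :=
    congrArg Subtype.val (hπ 0).1.1
  have h₁ : π.toMeasure.map Prod.snd = m₁.map e :=
    congrArg Subtype.val (hπ 0).1.2
  have hae (m : Measure (ℕ → ℝ)) : ∀ᵐ a ∂(m.map e), e (p a) = a := by
    have hs : MeasurableSet {a | e (p a) = a} := measurableSet_eq_fun (he.comp hp) measurable_id
    refine (ae_map_iff he.aemeasurable hs).2 ?_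
    exact ae_of_all _ fun x => congrArg e (congrFun hpe x)
  have hae₀ : ∀ᵐ z ∂π.toMeasure, e (p z.1) = z.1 :=
    ae_of_ae_map measurable_fst.aemeasurable (h₀ ▸ hae m₀)
  have hae₁ : ∀ᵐ z ∂π.toMeasure, e (p z.2) = z.2 :=
    ae_of_ae_map measurable_snd.aemeasurable (h₁ ▸ hae m₁)
  calc Wc Dinfty m₀ m₁
      ≤ ∫⁻ z, Dinfty z.1 z.2 ∂(π.toMeasure.map (Prod.map p p)) := by
        refine iInf₂_le _ ⟨?_, ?_⟩
        · rw [Measure.map_map measurable_fst (hp.prodMap hp)]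
          change π.toMeasure.map (p ∘ Prod.fst) = m₀
          rw [← Measure.map_map hp measurable_fst, h₀, Measure.map_map hp he, hpe, Measure.map_id]
        · rw [Measure.map_map measurable_snd (hp.prodMap hp)]
          change π.toMeasure.map (p ∘ Prod.snd) = m₁
          rw [← Measure.map_map hp measurable_snd, h₁, Measure.map_map hp he, hpe, Measure.map_id]
    _ ≤ ∫⁻ z, Dinfty (p z.1) (p z.2) ∂π.toMeasure := lintegral_map_le _ _
    _ ≤ ∫⁻ z, ⨆ n, ENNReal.ofReal (clipCost n z) ∂π.toMeasure := by
        refine lintegral_mono_ae ?_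
        filter_upwards [hae₀, hae₁] with z hz₀ hz₁
        have := Dinfty_le_iSup_clipCost (p z.1) (p z.2)
        change _ ≤ ⨆ n, ENNReal.ofReal (clipCost n (e (p z.1), e (p z.2))) at this
        rwa [hz₀, hz₁] at this
    _ = ⨆ n, ∫⁻ z, ENNReal.ofReal (clipCost n z) ∂π.toMeasure :=
        lintegral_iSup (fun n => (clipCost n).continuous.measurable.ennreal_ofReal)
          fun n m hnm z => ofReal_le_ofReal (hmono z hnm)
    _ ≤ ENNReal.ofReal S := by
        refine iSup_le fun n => ?_
        rw [← ofReal_integral_eq_lintegral_ofReal (hinteg n _)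
          (ae_of_all _ fun z => le_min dist_nonneg zero_le_one)]
        exact ofReal_le_ofReal (hπ n).2

/-- A function of bounded oscillation can be centred. -/
theorem exists_forall_abs_sub_le_half {X : Type*} [Nonempty X] {g : X → ℝ}
    (h : ∀ x y, g x - g y ≤ 1) : ∃ a, ∀ x, |g x - a| ≤ 1 / 2 := by
  obtain ⟨x₀⟩ := ‹Nonempty X›
  have : Nonempty X := ⟨x₀⟩
  have hbdd : BddAbove (range g) := ⟨g x₀ + 1, by rintro _ ⟨x, rfl⟩; linarith [h x x₀]⟩
  refine ⟨(⨆ x, g x) - 1 / 2, fun x => abs_le.2 ⟨?_, ?_⟩⟩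
  · have : ⨆ y, g y ≤ g x + 1 := ciSup_le fun y => by linarith [h y x]
    linarith
  · linarith [le_ciSup hbdd x]

theorem Wc_Dinfty_le_of_forall_lipschitzWith (m₀ m₁ : Measure (ℕ → ℝ)) [IsProbabilityMeasure m₀]
    [IsProbabilityMeasure m₁] (S : ℝ)
    (hS : ∀ (k : ℕ) (g : (Fin k → ℝ) → ℝ), LipschitzWith 1 g → (∀ y, |g y| ≤ 1 / 2) →
      (∫ x, g (fun i : Fin k => x i) ∂m₀) - ∫ x, g (fun i : Fin k => x i) ∂m₁ ≤ S) :
    Wc Dinfty m₀ m₁ ≤ ENNReal.ofReal S := by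
  refine Wc_Dinfty_le_of_forall_coupling m₀ m₁ S fun n => ?_
  let e : (ℕ → ℝ) → ℕ → EReal := fun x j => (x j : EReal)
  have he : Measurable e := measurable_pi_lambda _ fun j => (measurable_pi_apply j).coe_real_ereal
  have h₀ : IsProbabilityMeasure (m₀.map e) := Measure.isProbabilityMeasure_map he.aemeasurable
  have h₁ : IsProbabilityMeasure (m₁.map e) := Measure.isProbabilityMeasure_map he.aemeasurable
  refine exists_coupling_integral_le (m₀.map e) (m₁.map e) (clipCost n) (by simp [clipCost])
    (fun x y z => ?_) S fun f hf => ?_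
  · have := dist_triangle (clipPi n x) (clipPi n y) (clipPi n z)
    have h1 : 0 ≤ dist (clipPi n x) (clipPi n y) := dist_nonneg
    have h2 : 0 ≤ dist (clipPi n y) (clipPi n z) := dist_nonneg
    simp only [clipCost, ContinuousMap.coe_mk]
    grind
  let s : (Fin n → ℝ) → ℕ → EReal := fun y j => if h : j < n then (y ⟨j, h⟩ : EReal) else 0
  have hclip_s (x : ℕ → ℝ) : clipPi n (s fun i => x i) = clipPi n (e x) := by
    ext j; simp [clipPi, s, e]
  have hfs (x : ℕ → ℝ) : f (s fun i => x i) = f (e x) := by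
    have h1 := hf (s fun i => x i) (e x)
    have h2 := hf (e x) (s fun i => x i)
    simp only [clipCost, ContinuousMap.coe_mk, hclip_s, dist_self, zero_le_one, min_eq_left]
      at h1 h2
    linarith
  have hlip : LipschitzWith 1 fun y => f (s y) := by
    refine LipschitzWith.of_le_add_mul 1 fun y z => ?_
    have h1 := (hf (s y) (s z)).trans (min_le_left _ _)
    have h2 : dist (clipPi n (s y)) (clipPi n (s z)) ≤ dist y z := by
      refine (dist_pi_le_iff dist_nonneg).2 fun j => ?_
      simp only [clipPi, s, j.2, dif_pos]
      exact (abs_clip_coe_sub_clip_coe_le n _ _).trans (dist_le_pi_dist y z j)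
    simp only [NNReal.coe_one, one_mul]
    linarith
  obtain ⟨a, ha⟩ := exists_forall_abs_sub_le_half (g := fun y => f (s y)) fun y z =>
    (hf (s y) (s z)).trans (min_le_right _ _)
  have hlip' : LipschitzWith 1 fun y => f (s y) - a := by
    simpa using hlip.sub (LipschitzWith.const a)
  have := hS n (fun y => f (s y) - a) hlip' ha
  have hinteg (m : Measure (ℕ → ℝ)) [IsProbabilityMeasure m] :
      ∫ x, (f (s fun i : Fin n => x i) - a) ∂m = ∫ x, f x ∂(m.map e) - a := by
    have hi : Integrable f (m.map e) := by
      have := Measure.isProbabilityMeasure_map (μ := m) he.aemeasurable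
      exact f.continuous.integrable_of_hasCompactSupport (HasCompactSupport.of_compactSpace _)
    have hi' : Integrable (fun x => f (e x)) m := hi.comp_measurable he
    simp only [hfs]
    rw [integral_sub hi' (integrable_const a),
      integral_map he.aemeasurable (by fun_prop)]
    simp
  rw [hinteg, hinteg] at this
  linarith

/-- For `𝔪₀, 𝔪₁ ∈ P(ℝ^∞)`:
`W_{1,D_∞}(π^n_♯𝔪₀, π^n_♯𝔪₁) → W_{1,D_∞}(𝔪₀,𝔪₁)` as `n → ∞`, and the duality formula
`W_{1,D_∞}(𝔪₀,𝔪₁) = sup { ∫ Ψ∘p^k d(𝔪₀−𝔪₁) : k ∈ ℕ, Ψ ∈ C¹_c(ℝ^k), ‖Ψ‖_∞ ≤ 1/2,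
‖Σᵢ|∂ᵢΨ|‖_∞ ≤ 1 }` holds. -/
theorem truncation_limit_and_cylinder_duality
    (m₀ m₁ : Measure (ℕ → ℝ)) [IsProbabilityMeasure m₀] [IsProbabilityMeasure m₁] :
    Tendsto (fun n => Wc Dinfty (m₀.map (trunc n)) (m₁.map (trunc n))) atTop
      (nhds (Wc Dinfty m₀ m₁)) ∧
    Wc Dinfty m₀ m₁ =
      sSup {r : ℝ≥0∞ | ∃ (k : ℕ) (Ψ : (Fin k → ℝ) → ℝ),
        ContDiff ℝ 1 Ψ ∧ HasCompactSupport Ψ ∧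
        (∀ y, |Ψ y| ≤ 1 / 2) ∧
        (∀ y, (∑ i : Fin k, |fderiv ℝ Ψ y (Pi.single i 1)|) ≤ 1) ∧
        r = ENNReal.ofReal
          ((∫ x, Ψ (fun i : Fin k => x i) ∂m₀) - ∫ x, Ψ (fun i : Fin k => x i) ∂m₁)} := by
  have hdual : Wc Dinfty m₀ m₁ =
      sSup {r : ℝ≥0∞ | ∃ (k : ℕ) (Ψ : (Fin k → ℝ) → ℝ),
        ContDiff ℝ 1 Ψ ∧ HasCompactSupport Ψ ∧
        (∀ y, |Ψ y| ≤ 1 / 2) ∧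
        (∀ y, (∑ i : Fin k, |fderiv ℝ Ψ y (Pi.single i 1)|) ≤ 1) ∧
        r = ENNReal.ofReal
          ((∫ x, Ψ (fun i : Fin k => x i) ∂m₀) - ∫ x, Ψ (fun i : Fin k => x i) ∂m₁)} := by
    refine le_antisymm ?_ (sSup_le ?_)
    · refine le_of_forall_ge fun T hT => ?_
      rw [sSup_le_iff] at hT
      rcases eq_or_ne T ∞ with rfl | hTtop
      · exact le_top
      rw [← ofReal_toReal hTtop]
      refine Wc_Dinfty_le_of_forall_lipschitzWith m₀ m₁ T.toReal fun k g hg hgb => ?_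
      have hpr : Measurable fun (x : ℕ → ℝ) (i : Fin k) => x i := by fun_prop
      have hmap {u : (Fin k → ℝ) → ℝ} (hu : Continuous u) (m : Measure (ℕ → ℝ)) :
          ∫ x, u (fun i : Fin k => x i) ∂m = ∫ y, u y ∂(m.map fun x (i : Fin k) => x i) :=
        (integral_map hpr.aemeasurable hu.aestronglyMeasurable).symm
      have := Measure.isProbabilityMeasure_map (μ := m₀) hpr.aemeasurable
      have := Measure.isProbabilityMeasure_map (μ := m₁) hpr.aemeasurable
      rw [hmap hg.continuous, hmap hg.continuous]
      refine integral_sub_integral_le_of_forall_contDiff _ _ (fun Ψ hd hs hb hL => ?_) hg hgb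
      rw [← hmap hd.continuous, ← hmap hd.continuous, ← ofReal_le_iff_le_toReal hTtop]
      exact hT _ ⟨k, Ψ, hd, hs, hb, sum_abs_fderiv_single_le_one_of_lipschitzWith hL, rfl⟩
    · rintro _ ⟨k, Ψ, hd, -, hb, hsum, rfl⟩
      exact ofReal_integral_sub_integral_le_Wc m₀ m₁
        (lipschitzWith_one_of_sum_abs_fderiv_single_le_one hd hsum) hb
  refine ⟨tendsto_order.2 ⟨fun a ha => ?_, fun a ha => Eventually.of_forall fun n =>
    (Wc_Dinfty_map_trunc_le m₀ m₁ n).trans_lt ha⟩, hdual⟩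
  rw [hdual, lt_sSup_iff] at ha
  obtain ⟨_, ⟨k, Ψ, hd, -, hb, hsum, rfl⟩, har⟩ := ha
  filter_upwards [eventually_ge_atTop k] with n hn
  refine har.trans_le ?_
  have hT := measurable_trunc n
  have := Measure.isProbabilityMeasure_map (μ := m₀) hT.aemeasurable
  have := Measure.isProbabilityMeasure_map (μ := m₁) hT.aemeasurable
  have hmap (m : Measure (ℕ → ℝ)) : ∫ x, Ψ (fun i : Fin k => x i) ∂(m.map (trunc n)) =
      ∫ x, Ψ (fun i : Fin k => x i) ∂m := by
    have hc : Continuous fun x : ℕ → ℝ => Ψ fun i : Fin k => x i :=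
      hd.continuous.comp (by fun_prop)
    rw [integral_map hT.aemeasurable hc.aestronglyMeasurable]
    simp only [trunc, fun i : Fin k => i.2.trans_le hn, if_true]
  rw [← hmap m₀, ← hmap m₁]
  exact ofReal_integral_sub_integral_le_Wc _ _
    (lipschitzWith_one_of_sum_abs_fderiv_single_le_one hd hsum) hb

end
end

section
/- Let (X,d) be a complete separable metric space and p ≥ 1. Let λ ∈ P(C([0,T],X)) be concentrated on absolutely continuous curves γ satisfying ∫ d^p(x̄, γ(0)) dλ + ∫∫₀ᵀ |γ̇|^p(t) dt dλ(γ) < ∞ for some x̄ ∈ X. Then for all 0 ≤ s ≤ t ≤ T: W_p^p((e_s)_♯λ, (e_t)_♯λ) ≤ (t−s)^{p−1} ∫_s^t ∫ |γ̇|^p(r) dλ(γ) dr. In particular the curve t ↦ (e_t)_♯λ belongs to AC^p([0,T], P_p(X)). -/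
open MeasureTheory Set ENNReal Filter

noncomputable section

open scoped Topology

theorem IsACpOn.exists_integrableOn {X : Type*} [PseudoMetricSpace X] {T : ℝ} {γ : ℝ → X}
    (h : IsACpOn 1 T γ) :
    ∃ g : ℝ → ℝ, IntegrableOn g (Icc 0 T) ∧
      ∀ ⦃s t : ℝ⦄, s ∈ Icc 0 T → t ∈ Icc 0 T → s ≤ t →
        dist (γ s) (γ t) ≤ ∫ r in Icc s t, g r := by
  obtain ⟨g, g_nonneg, g_fin, g_le⟩ := h
  let U : Set ℝ := {x | IntegrableAtFilter g (𝓝 x)}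
  have hU : IsOpen U := by
    rw [isOpen_iff_mem_nhds]
    rintro x ⟨V, hV, hgV⟩
    filter_upwards [eventually_mem_nhds_iff.2 hV] with y hy using ⟨V, hy, hgV⟩
  have g_meas : AEStronglyMeasurable (U.indicator g) volume := by
    rw [aestronglyMeasurable_indicator_iff hU.measurableSet]
    refine LocallyIntegrableOn.aestronglyMeasurable fun x hx ↦ ?_
    exact hx.filter_mono nhdsWithin_le_nhds
  have ind_nonneg : ∀ r, 0 ≤ U.indicator g r := indicator_nonneg fun r _ ↦ g_nonneg r
  refine ⟨U.indicator g, ⟨g_meas.restrict, ?_⟩, fun s t hs ht hst ↦ ?_⟩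
  · rw [hasFiniteIntegral_iff_ofReal (ae_of_all _ ind_nonneg)]
    refine lt_of_le_of_lt (lintegral_mono fun r ↦ ?_) g_fin
    rw [Real.rpow_one]
    exact ENNReal.ofReal_le_ofReal (indicator_le_self' (fun _ _ ↦ g_nonneg _) r)
  · by_cases hg : IntegrableOn g (Icc s t)
    · refine (g_le hs ht hst).trans_eq ?_
      rw [integral_Icc_eq_integral_Ioo, integral_Icc_eq_integral_Ioo]
      refine setIntegral_congr_fun measurableSet_Ioo fun r hr ↦ ?_
      have : r ∈ U := ⟨Icc s t, Icc_mem_nhds hr.1 hr.2, hg⟩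
      simp [this]
    · refine (g_le hs ht hst).trans ?_
      rw [integral_undef hg]
      exact integral_nonneg ind_nonneg

theorem AbsolutelyContinuousOnInterval.of_dist_le {X Y : Type*} [PseudoMetricSpace X]
    [PseudoMetricSpace Y] {f : ℝ → X} {F : ℝ → Y} {a b : ℝ}
    (hF : AbsolutelyContinuousOnInterval F a b)
    (h : ∀ s ∈ uIcc a b, ∀ t ∈ uIcc a b, dist (f s) (f t) ≤ dist (F s) (F t)) :
    AbsolutelyContinuousOnInterval f a b := by
  rw [absolutelyContinuousOnInterval_iff] at hF ⊢
  intro ε hε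
  obtain ⟨δ, hδ, H⟩ := hF ε hε
  refine ⟨δ, hδ, fun E hE hEδ ↦ (Finset.sum_le_sum fun i hi ↦ ?_).trans_lt (H E hE hEδ)⟩
  exact h _ (hE.1 i hi).1 _ (hE.1 i hi).2

theorem HasDerivAt.tendsto_dist_div {f : ℝ → ℝ} {f' r : ℝ} (h : HasDerivAt f f' r) :
    Tendsto (fun s ↦ dist (f s) (f r) / |s - r|) (𝓝[≠] r) (𝓝 |f'|) := by
  refine (hasDerivAt_iff_tendsto_slope.1 h).abs.congr fun s ↦ ?_
  rw [slope_def_field, abs_div, Real.dist_eq]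

/-- A curve dominated by an absolutely continuous function has a metric derivative almost
everywhere, and it bounds the distance between points of the curve. -/
theorem exists_metric_derivative {X : Type*} [PseudoMetricSpace X]
    [TopologicalSpace.SeparableSpace X] {γ : ℝ → X} {F : ℝ → ℝ} {a b : ℝ} (hab : a ≤ b)
    (hF : AbsolutelyContinuousOnInterval F a b)
    (h : ∀ s ∈ Icc a b, ∀ t ∈ Icc a b, dist (γ s) (γ t) ≤ dist (F s) (F t)) :
    ∃ m : ℝ → ℝ, (∀ s ∈ Icc a b, ∀ t ∈ Icc a b, s ≤ t →
        IntegrableOn m (Icc s t) ∧ dist (γ s) (γ t) ≤ ∫ r in Icc s t, m r) ∧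
      (∀ r, 0 ≤ m r) ∧
      ∀ᵐ r, r ∈ Icc a b →
        Tendsto (fun s ↦ dist (γ s) (γ r) / |s - r|) (𝓝[≠] r) (𝓝 (m r)) := by
  have : Nonempty X := ⟨γ a⟩
  let x := TopologicalSpace.denseSeq X
  let φ : ℕ → ℝ → ℝ := fun n t ↦ dist (γ t) (x n)
  have φ_le (n : ℕ) (s t : ℝ) : dist (φ n s) (φ n t) ≤ dist (γ s) (γ t) :=
    dist_dist_dist_le_left _ _ _
  have φ_ac (n : ℕ) : AbsolutelyContinuousOnInterval (φ n) a b := by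
    refine hF.of_dist_le fun s hs t ht ↦ ?_
    rw [uIcc_of_le hab] at hs ht
    exact (φ_le n s t).trans (h s hs t ht)
  let m : ℝ → ℝ := fun r ↦ ⨆ n, |deriv (φ n) r|
  have m_nonneg (r : ℝ) : 0 ≤ m r := Real.iSup_nonneg fun n ↦ abs_nonneg _
  have m_meas : Measurable m := Measurable.iSup fun n ↦ (measurable_deriv _).abs
  have ae_ne : ∀ᵐ r : ℝ, r ≠ a ∧ r ≠ b := by
    filter_upwards [Measure.ae_ne volume a, Measure.ae_ne volume b] with r h1 h2 using ⟨h1, h2⟩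
  have ae_diff : ∀ᵐ r, r ∈ Icc a b → ∀ n, DifferentiableAt ℝ (φ n) r := by
    filter_upwards [ae_all_iff.2 fun n ↦ (φ_ac n).ae_differentiableAt] with r hr hrab n
    exact hr n (by rwa [uIcc_of_le hab])
  have ae_le : ∀ᵐ r, r ∈ Icc a b → ∀ n, |deriv (φ n) r| ≤ |deriv F r| := by
    filter_upwards [ae_diff, hF.ae_differentiableAt, ae_ne] with r hφ hFr hne hr n
    rw [uIcc_of_le hab] at hFr
    refine le_of_tendsto_of_tendsto (hφ hr n).hasDerivAt.tendsto_dist_div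
      (hFr hr).hasDerivAt.tendsto_dist_div ?_
    have : Icc a b ∈ 𝓝[≠] r := mem_nhdsWithin_of_mem_nhds <|
      Icc_mem_nhds (lt_of_le_of_ne hr.1 hne.1.symm) (lt_of_le_of_ne hr.2 hne.2)
    filter_upwards [this] with s hs
    gcongr
    exact (φ_le n s r).trans (h s hs r hr)
  have ae_bdd : ∀ᵐ r, r ∈ Icc a b → BddAbove (range fun n ↦ |deriv (φ n) r|) := by
    filter_upwards [ae_le] with r hr hrab
    exact ⟨_, forall_mem_range.2 (hr hrab)⟩
  have m_int : IntegrableOn m (Icc a b) := by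
    have F_int : IntegrableOn (deriv F) (Icc a b) :=
      (intervalIntegrable_iff_integrableOn_Icc_of_le hab).1 hF.intervalIntegrable_deriv
    refine Integrable.mono F_int m_meas.aestronglyMeasurable ?_
    rw [ae_restrict_iff' measurableSet_Icc]
    filter_upwards [ae_le] with r hr hrab
    rw [Real.norm_of_nonneg (m_nonneg r)]
    exact ciSup_le (hr hrab)
  have m_le : ∀ s ∈ Icc a b, ∀ t ∈ Icc a b, s ≤ t → dist (γ s) (γ t) ≤ ∫ r in Icc s t, m r := by
    intro s hs t ht hst
    have φ_bound (n : ℕ) : dist (φ n s) (φ n t) ≤ ∫ r in Icc s t, m r := by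
      have ac : AbsolutelyContinuousOnInterval (φ n) s t := (φ_ac n).mono (by
        rw [uIcc_of_le hab, uIcc_of_le hst]; exact Icc_subset_Icc hs.1 ht.2)
      rw [dist_comm, Real.dist_eq, ← ac.integral_deriv_eq_sub]
      refine (intervalIntegral.abs_integral_le_integral_abs hst).trans ?_
      rw [intervalIntegral.integral_of_le hst, ← integral_Icc_eq_integral_Ioc]
      refine integral_mono_ae ?_ (m_int.mono_set (Icc_subset_Icc hs.1 ht.2)) ?_
      · exact ((intervalIntegrable_iff_integrableOn_Icc_of_le hst).1
          ac.intervalIntegrable_deriv).abs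
      · refine (ae_restrict_iff' measurableSet_Icc).2 ?_
        filter_upwards [ae_bdd] with r hr hrst
        exact le_ciSup (hr ⟨hs.1.trans hrst.1, hrst.2.trans ht.2⟩) n
    refine le_of_forall_pos_le_add fun ε hε ↦ ?_
    obtain ⟨n, hn⟩ := (TopologicalSpace.denseRange_denseSeq X).exists_dist_lt (γ t) (half_pos hε)
    have h1 := φ_bound n
    have h2 : dist (γ s) (γ t) ≤ φ n s + φ n t := dist_triangle_right _ _ _
    have h3 : φ n s - φ n t ≤ dist (φ n s) (φ n t) := le_abs_self _
    have h4 : φ n t < ε / 2 := hn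
    linarith
  refine ⟨m, fun s hs t ht hst ↦ ⟨m_int.mono_set (Icc_subset_Icc hs.1 ht.2),
    m_le s hs t ht hst⟩, m_nonneg, ?_⟩
  have m_int' : IntervalIntegrable m volume a b :=
    (intervalIntegrable_iff_integrableOn_Icc_of_le hab).2 m_int
  have upper (s : ℝ) (hs : s ∈ Icc a b) (t : ℝ) (ht : t ∈ Icc a b) :
      dist (γ s) (γ t) ≤ dist (∫ r in a..s, m r) (∫ r in a..t, m r) := by
    wlog hst : s ≤ t generalizing s t
    · rw [dist_comm, dist_comm (∫ r in a..s, m r)]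
      exact this t ht s hs (le_of_not_ge hst)
    have hsub {u : ℝ} (hu : u ∈ Icc a b) : IntervalIntegrable m volume a u :=
      m_int'.mono_set (by rw [uIcc_of_le hab, uIcc_of_le hu.1]; exact Icc_subset_Icc_right hu.2)
    rw [dist_comm (∫ r in a..s, m r), Real.dist_eq,
      intervalIntegral.integral_interval_sub_left (hsub ht) (hsub hs),
      intervalIntegral.integral_of_le hst, ← integral_Icc_eq_integral_Ioc]
    exact (m_le s hs t ht hst).trans (le_abs_self _)
  filter_upwards [ae_diff, ae_ne, m_int'.ae_hasDerivAt_integral] with r hφ hne hM hr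
  rw [uIcc_of_le hab] at hM
  have M_tendsto := (hM hr a (left_mem_Icc.2 hab)).tendsto_dist_div
  rw [abs_of_nonneg (m_nonneg r)] at M_tendsto
  have hmem : Icc a b ∈ 𝓝[≠] r := mem_nhdsWithin_of_mem_nhds <|
    Icc_mem_nhds (lt_of_le_of_ne hr.1 hne.1.symm) (lt_of_le_of_ne hr.2 hne.2)
  refine tendsto_order.2 ⟨fun c hc ↦ ?_, fun c hc ↦ ?_⟩
  · obtain ⟨n, hn⟩ := exists_lt_of_lt_ciSup hc
    filter_upwards [(hφ hr n).hasDerivAt.tendsto_dist_div.eventually_const_lt hn] with s hs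
    refine hs.trans_le ?_
    gcongr
    exact φ_le n s r
  · filter_upwards [M_tendsto.eventually_lt_const hc, hmem] with s hs hsab
    refine lt_of_le_of_lt ?_ hs
    gcongr
    exact upper s hsab r hr

theorem IsACpOn.edist_le_lintegral_mSpeed {X : Type*} [PseudoMetricSpace X]
    [TopologicalSpace.SeparableSpace X] {T : ℝ} {γ : ℝ → X} (h : IsACpOn 1 T γ)
    {s t : ℝ} (hs : s ∈ Icc 0 T) (ht : t ∈ Icc 0 T) (hst : s ≤ t) :
    edist (γ s) (γ t) ≤ ∫⁻ r in Icc s t, ENNReal.ofReal (mSpeed γ r) := by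
  have hT : 0 ≤ T := hs.1.trans hs.2
  obtain ⟨g, g_int, hg⟩ := h.exists_integrableOn
  have g_int' : IntervalIntegrable g volume 0 T :=
    (intervalIntegrable_iff_integrableOn_Icc_of_le hT).2 g_int
  have dom (s : ℝ) (hs : s ∈ Icc 0 T) (t : ℝ) (ht : t ∈ Icc 0 T) :
      dist (γ s) (γ t) ≤ dist (∫ r in 0..s, g r) (∫ r in 0..t, g r) := by
    wlog hst : s ≤ t generalizing s t
    · rw [dist_comm, dist_comm (∫ r in 0..s, g r)]
      exact this t ht s hs (le_of_not_ge hst)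
    have hsub {u : ℝ} (hu : u ∈ Icc 0 T) : IntervalIntegrable g volume 0 u :=
      g_int'.mono_set (by rw [uIcc_of_le hT, uIcc_of_le hu.1]; exact Icc_subset_Icc_right hu.2)
    rw [dist_comm (∫ r in 0..s, g r), Real.dist_eq,
      intervalIntegral.integral_interval_sub_left (hsub ht) (hsub hs),
      intervalIntegral.integral_of_le hst, ← integral_Icc_eq_integral_Ioc]
    exact (hg hs ht hst).trans (le_abs_self _)
  obtain ⟨m, hm, m_nonneg, m_tendsto⟩ := exists_metric_derivative hT
    (g_int'.absolutelyContinuousOnInterval_intervalIntegral (c := 0) left_mem_uIcc) dom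
  obtain ⟨m_int, m_le⟩ := hm s hs t ht hst
  have speed_eq : ∀ᵐ r ∂volume.restrict (Icc s t), mSpeed γ r = m r := by
    refine (ae_restrict_iff' measurableSet_Icc).2 ?_
    filter_upwards [m_tendsto] with r hr hrst
    exact (hr ⟨hs.1.trans hrst.1, hrst.2.trans ht.2⟩).limUnder_eq
  calc edist (γ s) (γ t) = ENNReal.ofReal (dist (γ s) (γ t)) := edist_dist _ _
    _ ≤ ENNReal.ofReal (∫ r in Icc s t, m r) := ENNReal.ofReal_le_ofReal m_le
    _ = ∫⁻ r in Icc s t, ENNReal.ofReal (m r) :=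
      ofReal_integral_eq_lintegral_ofReal m_int (ae_of_all _ m_nonneg)
    _ = ∫⁻ r in Icc s t, ENNReal.ofReal (mSpeed γ r) :=
      lintegral_congr_ae (speed_eq.mono fun r hr ↦ by simp only [hr])

theorem tendsto_comap_ratCast_nhdsNE_iff {f : ℝ → ℝ} (hf : ContinuousOn f {0}ᶜ) {c : ℝ} :
    Tendsto (fun q : ℚ ↦ f q) (comap (↑) (𝓝[≠] (0 : ℝ))) (𝓝 c) ↔
      Tendsto f (𝓝[≠] 0) (𝓝 c) := by
  refine ⟨fun h ↦ ?_, fun h ↦ h.comp tendsto_comap⟩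
  refine (closed_nhds_basis c).tendsto_right_iff.2 fun V ⟨hV, V_closed⟩ ↦ ?_
  have := h.eventually_mem hV
  rw [eventually_comap, eventually_nhdsWithin_iff] at this
  obtain ⟨U, hU, U_open, mem_U⟩ := eventually_nhds_iff.1 this
  filter_upwards [mem_nhdsWithin_of_mem_nhds (U_open.mem_nhds mem_U), self_mem_nhdsWithin]
    with x hxU hx
  have W_open : IsOpen (U ∩ {0}ᶜ) := U_open.inter isOpen_compl_singleton
  have x_mem : x ∈ closure (U ∩ {0}ᶜ ∩ range ((↑) : ℚ → ℝ)) :=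
    Rat.denseRange_cast.open_subset_closure_inter W_open ⟨hxU, hx⟩
  have hfx : ContinuousWithinAt f (U ∩ {0}ᶜ ∩ range ((↑) : ℚ → ℝ)) x :=
    (hf x hx).mono fun y hy ↦ hy.1.2
  refine closure_minimal ?_ V_closed (hfx.mem_closure_image x_mem)
  rintro _ ⟨_, ⟨hy, q, rfl⟩, rfl⟩
  exact hU _ hy.1 hy.2 q rfl

theorem mSpeed_eq_limUnder_ratCast {X : Type*} [PseudoMetricSpace X] {γ : ℝ → X}
    (hγ : Continuous γ) (r : ℝ) :
    mSpeed γ r = limUnder (comap ((↑) : ℚ → ℝ) (𝓝[≠] (0 : ℝ)))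
      (fun q : ℚ ↦ dist (γ (r + q)) (γ r) / |(q : ℝ)|) := by
  have hmap : 𝓝[≠] r = map (r + ·) (𝓝[≠] 0) := by
    rw [Filter.map_add_left_nhdsNE, add_zero]
  unfold mSpeed limUnder lim
  congr 1
  funext c
  rw [hmap, map_map]
  refine propext (Iff.trans (Eq.to_iff ?_) (tendsto_comap_ratCast_nhdsNE_iff
    (f := fun h ↦ dist (γ (r + h)) (γ r) / |h|) (c := c) ?_).symm)
  · simp only [Tendsto, Function.comp_def, add_sub_cancel_left]
  · exact ContinuousOn.div (by fun_prop) (by fun_prop) fun x hx ↦ abs_ne_zero.2 hx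

theorem continuous_uncurry_extendIcc {X : Type*} [TopologicalSpace X] {T : ℝ} (hT : 0 ≤ T) :
    Continuous fun z : C(Icc (0 : ℝ) T, X) × ℝ ↦ extendIcc hT z.1 z.2 :=
  continuous_fst.eval (continuous_projIcc.comp continuous_snd)

theorem measurable_mSpeed_extendIcc {X : Type*} [PseudoMetricSpace X] {T : ℝ} (hT : 0 ≤ T)
    [MeasurableSpace C(Icc (0 : ℝ) T, X)] [BorelSpace C(Icc (0 : ℝ) T, X)] :
    Measurable fun z : C(Icc (0 : ℝ) T, X) × ℝ ↦ mSpeed (extendIcc hT z.1) z.2 := by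
  have hext := continuous_uncurry_extendIcc (X := X) hT
  have heq (z : C(Icc (0 : ℝ) T, X) × ℝ) := mSpeed_eq_limUnder_ratCast
    (hext.comp (Continuous.prodMk_right z.1)) z.2
  simp only [Function.comp_def] at heq
  simp only [funext heq]
  refine (StronglyMeasurable.limUnder fun q ↦ Measurable.stronglyMeasurable ?_).measurable
  refine (Continuous.dist ?_ hext).measurable.div_const _
  exact hext.comp (by fun_prop : Continuous fun z : C(Icc (0 : ℝ) T, X) × ℝ ↦ (z.1, z.2 + (q : ℝ)))

theorem lintegral_rpow_le_measure_univ_rpow_mul {α : Type*} [MeasurableSpace α] {μ : Measure α}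
    {p : ℝ} (hp : 1 ≤ p) {f : α → ℝ≥0∞} (hf : AEMeasurable f μ) :
    (∫⁻ x, f x ∂μ) ^ p ≤ μ univ ^ (p - 1) * ∫⁻ x, f x ^ p ∂μ := by
  rcases hp.eq_or_lt with rfl | hp
  · simp
  have hpq : p.HolderConjugate p.conjExponent := .conjExponent hp
  have key := ENNReal.lintegral_mul_le_Lp_mul_Lq μ hpq hf aemeasurable_one
  simp only [Pi.mul_apply, mul_one, ENNReal.one_rpow, lintegral_one] at key
  refine (ENNReal.rpow_le_rpow key hpq.nonneg).trans_eq ?_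
  rw [ENNReal.mul_rpow_of_nonneg _ _ hpq.nonneg, ← ENNReal.rpow_mul, ← ENNReal.rpow_mul,
    one_div_mul_cancel hpq.ne_zero, ENNReal.rpow_one, mul_comm]
  congr 2
  rw [one_div, inv_mul_eq_div, hpq.div_conj_eq_sub_one]

/-- **Minkowski's integral inequality**. -/
theorem lintegral_lintegral_rpow_le {α β : Type*} [MeasurableSpace α] [MeasurableSpace β]
    {μ : Measure α} {ν : Measure β} [SFinite μ] [SFinite ν] {p : ℝ} (hp : 1 ≤ p)
    {f : α → β → ℝ≥0∞} (hf : Measurable (Function.uncurry f))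
    (hfin : ∫⁻ x, (∫⁻ y, f x y ∂ν) ^ p ∂μ ≠ ⊤) :
    ∫⁻ x, (∫⁻ y, f x y ∂ν) ^ p ∂μ ≤ (∫⁻ y, (∫⁻ x, f x y ^ p ∂μ) ^ (1 / p) ∂ν) ^ p := by
  rcases hp.eq_or_lt with rfl | hp
  · simpa using (lintegral_lintegral_swap hf.aemeasurable).le
  have hpq : p.HolderConjugate p.conjExponent := .conjExponent hp
  set q := p.conjExponent
  let A : α → ℝ≥0∞ := fun x ↦ ∫⁻ y, f x y ∂ν
  have hA : Measurable A := hf.lintegral_prod_right'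
  have hAp : Measurable fun x ↦ A x ^ (p - 1) := hA.pow_const _
  have hf_right (x : α) : Measurable (f x) := hf.comp measurable_prodMk_left
  have hf_left (y : β) : Measurable fun x ↦ f x y := hf.comp measurable_prodMk_right
  have hG : Measurable fun y ↦ (∫⁻ x, f x y ^ p ∂μ) ^ (1 / p) :=
    (Measurable.lintegral_prod_left' (hf.pow_const p)).pow_const _
  set I := ∫⁻ x, A x ^ p ∂μ
  set K := ∫⁻ y, (∫⁻ x, f x y ^ p ∂μ) ^ (1 / p) ∂ν
  have key : I ≤ I ^ (1 / q) * K := calc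
    I = ∫⁻ x, ∫⁻ y, A x ^ (p - 1) * f x y ∂ν ∂μ := by
      refine lintegral_congr fun x ↦ ?_
      rw [lintegral_const_mul _ (hf_right x)]
      simpa [A] using
        ENNReal.rpow_add_of_nonneg (x := A x) (p - 1) 1 (sub_nonneg.2 hp.le) zero_le_one
    _ = ∫⁻ y, ∫⁻ x, A x ^ (p - 1) * f x y ∂μ ∂ν :=
      lintegral_lintegral_swap ((hAp.comp measurable_fst).mul hf).aemeasurable
    _ ≤ ∫⁻ y, I ^ (1 / q) * (∫⁻ x, f x y ^ p ∂μ) ^ (1 / p) ∂ν := by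
      refine lintegral_mono fun y ↦ ?_
      refine (ENNReal.lintegral_mul_le_Lp_mul_Lq μ hpq.symm hAp.aemeasurable
        (hf_left y).aemeasurable).trans_eq ?_
      simp only [← ENNReal.rpow_mul, hpq.sub_one_mul_conj, I]
    _ = I ^ (1 / q) * K := lintegral_const_mul _ hG
  change I ≤ K ^ p
  rcases eq_or_ne I 0 with hI | hI
  · simp [hI]
  have hsplit : I = I ^ (1 / q) * I ^ (1 / p) := by
    rw [← ENNReal.rpow_add _ _ hI hfin, one_div, one_div, add_comm, hpq.inv_add_inv_eq_one,
      ENNReal.rpow_one]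
  have hle : I ^ (1 / p) ≤ K := by
    refine (ENNReal.mul_le_mul_iff_right ?_ ?_).1 (hsplit.symm.trans_le key)
    · exact (ENNReal.rpow_pos (pos_iff_ne_zero.2 hI) hfin).ne'
    · exact ENNReal.rpow_ne_top_of_nonneg hpq.symm.one_div_nonneg hfin
  rw [one_div] at hle
  exact (ENNReal.rpow_inv_le_iff hpq.pos).1 hle

theorem Wpp_map_le {Ω X : Type*} [MeasurableSpace Ω] [PseudoEMetricSpace X]
    [SecondCountableTopology X] [MeasurableSpace X] [BorelSpace X] (p : ℝ) (μ : Measure Ω)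
    {f g : Ω → X} (hf : Measurable f) (hg : Measurable g) :
    Wpp p (μ.map f) (μ.map g) ≤ ∫⁻ ω, edist (f ω) (g ω) ^ p ∂μ := by
  have hmem : μ.map (fun ω ↦ (f ω, g ω)) ∈ couplings (μ.map f) (μ.map g) :=
    ⟨Measure.map_map measurable_fst (hf.prodMk hg), Measure.map_map measurable_snd (hf.prodMk hg)⟩
  exact (iInf₂_le _ hmem).trans_eq (lintegral_map (by fun_prop) (hf.prodMk hg))

/-- Let `(X,d)` be complete separable, `p ≥ 1`, and let
`λ ∈ P(C([0,T],X))` be concentrated on absolutely continuous curves and satisfy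
`∫ d^p(x̄,γ(0)) dλ + ∫∫₀ᵀ |γ̇|^p dλ < ∞`.  Then for `0 ≤ s ≤ t ≤ T`,
`W_p^p((e_s)_♯λ, (e_t)_♯λ) ≤ (t−s)^{p−1} ∫_s^t ∫ |γ̇|^p(r) dλ dr`; in particular the curve
`t ↦ (e_t)_♯λ` belongs to `AC^p([0,T], P_p(X))`. -/
theorem wasserstein_estimate_for_pushforward_curve
    {X : Type*} [MetricSpace X] [CompleteSpace X] [TopologicalSpace.SeparableSpace X]
    [MeasurableSpace X] [BorelSpace X]
    (T p : ℝ) (hT : 0 < T) (hp : 1 ≤ p) (xb : X)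
    [MeasurableSpace C(Icc (0:ℝ) T, X)] [BorelSpace C(Icc (0:ℝ) T, X)]
    (lam : Measure C(Icc (0:ℝ) T, X)) [IsProbabilityMeasure lam]
    (hAC : ∀ᵐ γ ∂lam, IsACpOn 1 T (extendIcc hT.le γ))
    (hmom : ∫⁻ γ, edist (extendIcc hT.le γ 0) xb ^ p ∂lam < ⊤)
    (hen : ∫⁻ γ, (∫⁻ r in Icc (0:ℝ) T,
        ENNReal.ofReal (mSpeed (extendIcc hT.le γ) r ^ p)) ∂lam < ⊤) :
    (∀ ⦃s t : ℝ⦄, s ∈ Icc (0:ℝ) T → t ∈ Icc (0:ℝ) T → s ≤ t →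
      Wpp p (lam.map (fun γ => extendIcc hT.le γ s)) (lam.map (fun γ => extendIcc hT.le γ t))
        ≤ ENNReal.ofReal ((t - s) ^ (p - 1)) *
          ∫⁻ r in Icc s t, (∫⁻ γ, ENNReal.ofReal (mSpeed (extendIcc hT.le γ) r ^ p) ∂lam)) ∧
    (∀ t ∈ Icc (0:ℝ) T,
      ∫⁻ x, edist x xb ^ p ∂(lam.map (fun γ => extendIcc hT.le γ t)) < ⊤) ∧
    (∃ G : ℝ → ℝ≥0∞, (∫⁻ r in Icc (0:ℝ) T, G r ^ p) < ⊤ ∧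
      ∀ ⦃s t : ℝ⦄, s ∈ Icc (0:ℝ) T → t ∈ Icc (0:ℝ) T → s ≤ t →
        Wpp p (lam.map (fun γ => extendIcc hT.le γ s))
            (lam.map (fun γ => extendIcc hT.le γ t))
          ≤ (∫⁻ r in Icc s t, G r) ^ p) := by
  have hp0 : 0 ≤ p := zero_le_one.trans hp
  have hspeed := measurable_mSpeed_extendIcc (X := X) hT.le
  let E : C(Icc (0 : ℝ) T, X) → ℝ → ℝ≥0∞ := fun γ r ↦
    ENNReal.ofReal (mSpeed (extendIcc hT.le γ) r ^ p)
  let v : C(Icc (0 : ℝ) T, X) → ℝ → ℝ≥0∞ := fun γ r ↦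
    ENNReal.ofReal (mSpeed (extendIcc hT.le γ) r)
  have hE : Measurable (Function.uncurry E) := (hspeed.pow_const p).ennreal_ofReal
  have hv : Measurable (Function.uncurry v) := hspeed.ennreal_ofReal
  have v_le (γ : C(Icc (0 : ℝ) T, X)) (r : ℝ) : v γ r ^ p ≤ E γ r := by
    rcases le_or_gt 0 (mSpeed (extendIcc hT.le γ) r) with h | h
    · exact (ENNReal.ofReal_rpow_of_nonneg h hp0).le
    · simp [v, ENNReal.ofReal_of_nonpos h.le, ENNReal.zero_rpow_of_pos (zero_lt_one.trans_le hp)]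
  have swap (s t : ℝ) : ∫⁻ γ, (∫⁻ r in Icc s t, E γ r) ∂lam =
      ∫⁻ r in Icc s t, ∫⁻ γ, E γ r ∂lam :=
    lintegral_lintegral_swap hE.aemeasurable
  have eval_cont (t : ℝ) : Continuous fun γ : C(Icc (0 : ℝ) T, X) ↦ extendIcc hT.le γ t :=
    (continuous_uncurry_extendIcc hT.le).comp (Continuous.prodMk_left t)
  have dist_le ⦃s t : ℝ⦄ (hs : s ∈ Icc 0 T) (ht : t ∈ Icc 0 T) (hst : s ≤ t) :
      ∫⁻ γ, edist (extendIcc hT.le γ s) (extendIcc hT.le γ t) ^ p ∂lam ≤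
        ∫⁻ γ, (∫⁻ r in Icc s t, v γ r) ^ p ∂lam := by
    refine lintegral_mono_ae (hAC.mono fun γ hγ ↦ ?_)
    exact ENNReal.rpow_le_rpow (hγ.edist_le_lintegral_mSpeed hs ht hst) hp0
  have length_le ⦃s t : ℝ⦄ (hst : s ≤ t) :
      ∫⁻ γ, (∫⁻ r in Icc s t, v γ r) ^ p ∂lam ≤
        ENNReal.ofReal ((t - s) ^ (p - 1)) * ∫⁻ r in Icc s t, ∫⁻ γ, E γ r ∂lam := by
    rw [← swap, ← lintegral_const_mul' _ _ ENNReal.ofReal_ne_top]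
    refine lintegral_mono fun γ ↦ (lintegral_rpow_le_measure_univ_rpow_mul hp
      (hv.comp measurable_prodMk_left).aemeasurable).trans ?_
    rw [Measure.restrict_apply_univ, Real.volume_Icc,
      ENNReal.ofReal_rpow_of_nonneg (sub_nonneg.2 hst) (sub_nonneg.2 hp)]
    gcongr with r
    exact v_le γ r
  have energy_lt : ∫⁻ r in Icc 0 T, ∫⁻ γ, E γ r ∂lam < ⊤ := (swap 0 T).symm.trans_lt hen
  have length_lt ⦃s t : ℝ⦄ (hs : s ∈ Icc 0 T) (ht : t ∈ Icc 0 T) (hst : s ≤ t) :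
      ∫⁻ γ, (∫⁻ r in Icc s t, v γ r) ^ p ∂lam < ⊤ :=
    (length_le hst).trans_lt <| ENNReal.mul_lt_top ENNReal.ofReal_lt_top <|
      (lintegral_mono_set (Icc_subset_Icc hs.1 ht.2)).trans_lt energy_lt
  have Wpp_le ⦃s t : ℝ⦄ (hs : s ∈ Icc 0 T) (ht : t ∈ Icc 0 T) (hst : s ≤ t) :=
    (Wpp_map_le p lam (eval_cont s).measurable (eval_cont t).measurable).trans
      (dist_le hs ht hst)
  refine ⟨fun s t hs ht hst ↦ (Wpp_le hs ht hst).trans (length_le hst), fun t ht ↦ ?_,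
    fun r ↦ (∫⁻ γ, v γ r ^ p ∂lam) ^ (1 / p), ?_, fun s t hs ht hst ↦ (Wpp_le hs ht hst).trans <|
      lintegral_lintegral_rpow_le hp hv (length_lt hs ht hst).ne⟩
  · have h0 : (0 : ℝ) ∈ Icc 0 T := left_mem_Icc.2 hT.le
    rw [lintegral_map (by fun_prop) (eval_cont t).measurable]
    calc ∫⁻ γ, edist (extendIcc hT.le γ t) xb ^ p ∂lam
        ≤ ∫⁻ γ, 2 ^ (p - 1) * (edist (extendIcc hT.le γ 0) (extendIcc hT.le γ t) ^ p
            + edist (extendIcc hT.le γ 0) xb ^ p) ∂lam := by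
          refine lintegral_mono fun γ ↦ le_trans ?_ (ENNReal.rpow_add_le_mul_rpow_add_rpow _ _ hp)
          exact ENNReal.rpow_le_rpow (edist_triangle_left _ _ _) hp0
      _ = 2 ^ (p - 1) * (∫⁻ γ, edist (extendIcc hT.le γ 0) (extendIcc hT.le γ t) ^ p ∂lam
            + ∫⁻ γ, edist (extendIcc hT.le γ 0) xb ^ p ∂lam) := by
          rw [lintegral_const_mul' _ _ (by finiteness), lintegral_add_left]
          exact (((eval_cont 0).edist (eval_cont t)).measurable).pow_const p
      _ < ⊤ := ENNReal.mul_lt_top (by finiteness) <| ENNReal.add_lt_top.2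
          ⟨(dist_le h0 ht ht.1).trans_lt (length_lt h0 ht ht.1), hmom⟩
  · simp only [← ENNReal.rpow_mul, one_div_mul_cancel (zero_lt_one.trans_le hp).ne',
      ENNReal.rpow_one]
    exact (lintegral_mono fun r ↦ lintegral_mono fun γ ↦ v_le γ r).trans_lt energy_lt

end
end
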